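/- Let 1 < p < ∞ and n ≥ 1. There exists a constant C_0 = C_0(n,p) > 0 with the following property. Let U ⊂ ℝ^n be a nonempty open, bounded, connected set and let u ∈ W^{1,∞}(U,ℝ^n) satisfy diam(u(U)) ≤ d, mult_U(u) ≤ m, and 0 < λ ≤ det Du(x) ≤ Λ for a.e. x ∈ U. Then there exists a bounded Lipschitz map s : U → ℝ^n that is measure preserving such that ∫_U |u(x) − (|u(U)|/|U|)^{1/n} s(x)|^p dx ≤ C_0 · m^{3p−2} (d/λ)^p (Λ/λ)^{2p−2} · ∫_U | |u(U)|/|U| − 1/ω_u(u(x)) |^p dx. -/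

import Mathlib

open MeasureTheory Metric Set Bornology

noncomputable section

/-- The Jacobian determinant of `u` at `x` (junk value if `u` is not differentiable at `x`). -/
def detD {n : ℕ} (u : EuclideanSpace ℝ (Fin n) → EuclideanSpace ℝ (Fin n))
    (x : EuclideanSpace ℝ (Fin n)) : ℝ :=
  LinearMap.det ((fderiv ℝ u x).toLinearMap)

/-- `ω_u(y) = Σ_{x ∈ P_u(y)} 1/det Du(x)`, where
`P_u(y) = {x ∈ U : u x = y, u differentiable at x, det Du(x) > 0}`; the sum is taken in
`ℝ≥0∞`, so it is `0` if `P_u(y)` is empty and `∞` if `P_u(y)` is uncountable. -/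
def omegaFn {n : ℕ} (U : Set (EuclideanSpace ℝ (Fin n)))
    (u : EuclideanSpace ℝ (Fin n) → EuclideanSpace ℝ (Fin n))
    (y : EuclideanSpace ℝ (Fin n)) : ENNReal :=
  ∑' x : {x : EuclideanSpace ℝ (Fin n) //
      x ∈ U ∧ u x = y ∧ DifferentiableAt ℝ u x ∧ 0 < detD u x},
    ENNReal.ofReal (detD u x.1)⁻¹

/-- A bounded lattice step function is realised off small gaps by a bounded Lipschitz function. -/
theorem stepLip (a h : ℝ) (hh : 0 < h) (ψ : ℤ → ℝ) (C : ℝ) (hC : ∀ k, |ψ k| ≤ C)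
    (δ : ℝ) (hδ : 0 < δ) (_hδ2 : δ < 1/2) :
    ∃ φ : ℝ → ℝ, (∃ K, LipschitzWith K φ) ∧ (∀ t, |φ t| ≤ C) ∧
      ∀ (k : ℤ) (y : ℝ), y ∈ Icc δ (1-δ) → φ (a + h * (k + y)) = ψ k := by
  have hC0 : 0 ≤ C := le_trans (abs_nonneg _) (hC 0)
  set s : Set ℝ := {t | ∃ (k : ℤ) (y : ℝ), y ∈ Icc δ (1-δ) ∧ t = a + h * (k + y)} with hs
  set f : ℝ → ℝ := fun t => ψ ⌊(t - a)/h⌋ with hf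
  have hfv : ∀ (k : ℤ) (y : ℝ), y ∈ Icc δ (1-δ) → f (a + h * (k + y)) = ψ k := by
    intro k y hy
    have : ⌊(a + h * (k + y) - a)/h⌋ = k := by
      rw [show (a + h * (k + y) - a)/h = k + y by field_simp; ring]
      rw [Int.floor_eq_iff]
      constructor <;> linarith [hy.1, hy.2]
    simp only [hf, this]
  have hL : LipschitzOnWith (Real.toNNReal (C / (δ * h))) f s := by
    apply LipschitzOnWith.of_dist_le_mul
    rintro x ⟨k, y, hy, rfl⟩ x' ⟨k', y', hy', rfl⟩
    rw [hfv k y hy, hfv k' y' hy', Real.coe_toNNReal _ (by positivity), Real.dist_eq, Real.dist_eq]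
    by_cases hk : k = k'
    · subst hk
      simp only [sub_self, abs_zero]
      positivity
    · have h1 : |ψ k - ψ k'| ≤ 2 * C := by
        have := abs_sub (ψ k) (ψ k')
        linarith [hC k, hC k']
      have h2 : 2 * δ ≤ |((k:ℝ) + y) - (k' + y')| := by
        rcases lt_or_gt_of_ne hk with h | h
        · have : (k:ℝ) + 1 ≤ k' := by exact_mod_cast h
          rw [abs_sub_comm]
          refine le_trans ?_ (le_abs_self _)
          linarith [hy.1, hy.2, hy'.1, hy'.2]
        · have : (k':ℝ) + 1 ≤ k := by exact_mod_cast h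
          refine le_trans ?_ (le_abs_self _)
          linarith [hy.1, hy.2, hy'.1, hy'.2]
      have h3 : |a + h * (k + y) - (a + h * (k' + y'))| = h * |((k:ℝ) + y) - (k' + y')| := by
        rw [show a + h * (k + y) - (a + h * (k' + y')) = h * (((k:ℝ) + y) - (k' + y')) by ring,
          abs_mul, abs_of_pos hh]
      rw [h3]
      calc |ψ k - ψ k'| ≤ 2 * C := h1
        _ = C / (δ * h) * (h * (2 * δ)) := by field_simp
        _ ≤ _ := by gcongr
  obtain ⟨φ, hφ, hφs⟩ := hL.extend_real
  refine ⟨fun t => max (-C) (min C (φ t)), ⟨_, (hφ.const_min C).const_max (-C)⟩, ?_, ?_⟩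
  · intro t
    rw [abs_le]
    exact ⟨le_max_left _ _, max_le (by linarith) (min_le_left _ _)⟩
  · intro k y hy
    have : φ (a + h * (k + y)) = ψ k := by
      rw [← hφs ⟨k, y, hy, rfl⟩, hfv k y hy]
    have h2 := abs_le.1 (hC k)
    simp only [this]
    rw [min_eq_right h2.2, max_eq_right h2.1]

/-- lattice maps realised by Lipschitz volume preserving maps -/
def Rz {n : ℕ} (a h : ℝ) (t : (Fin n → ℤ) → (Fin n → ℤ)) : Prop :=
  ∃ D : ℝ, ∀ δ : ℝ, 0 < δ → δ < 1/2 → ∃ g : (Fin n → ℝ) ≃ᵐ (Fin n → ℝ),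
    MeasurePreserving g volume volume ∧ (∃ K, LipschitzWith K g) ∧ (∀ x, ‖g x - x‖ ≤ D) ∧
    ∀ (P : Fin n → ℤ) (y : Fin n → ℝ), (∀ i, y i ∈ Icc δ (1-δ)) →
      g (fun i => a + h * (P i + y i)) = fun i => a + h * (t P i + y i)

theorem Rz_id {n : ℕ} (a h : ℝ) : Rz (n := n) a h (fun P => P) :=
  ⟨0, fun _ _ _ => ⟨MeasurableEquiv.refl _, MeasurePreserving.id _, ⟨1, LipschitzWith.id⟩,
    by simp, fun _ _ _ => rfl⟩⟩

theorem Rz_comp {n : ℕ} {a h : ℝ} {t t' : (Fin n → ℤ) → (Fin n → ℤ)} (ht : Rz a h t)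
    (ht' : Rz a h t') : Rz a h (fun P => t (t' P)) := by
  obtain ⟨D, H⟩ := ht
  obtain ⟨D', H'⟩ := ht'
  refine ⟨D + D', fun δ h1 h2 => ?_⟩
  obtain ⟨g, hg, ⟨K, hK⟩, hd, he⟩ := H δ h1 h2
  obtain ⟨g', hg', ⟨K', hK'⟩, hd', he'⟩ := H' δ h1 h2
  refine ⟨g'.trans g, hg.comp hg', ⟨K * K', hK.comp hK'⟩, ?_, ?_⟩
  · intro x
    have : (g'.trans g) x - x = (g (g' x) - g' x) + (g' x - x) := by
      simp
    rw [this]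
    exact (norm_add_le _ _).trans (add_le_add (hd _) (hd' _))
  · intro P y hy
    simp only [MeasurableEquiv.trans_apply, he' P y hy, he (t' P) y hy]

theorem Rz_shear {n : ℕ} (a h : ℝ) (hh : 0 < h) (i j : Fin n) (hij : j ≠ i) (ψ : ℤ → ℤ)
    (hψ : ∃ C : ℝ, ∀ k, |(ψ k : ℝ)| ≤ C) :
    Rz a h (fun P => Function.update P i (P i + ψ (P j))) := by
  obtain ⟨C, hC⟩ := hψ
  have hC0 : 0 ≤ C := le_trans (abs_nonneg _) (hC 0)
  refine ⟨h * C, fun δ h1 h2 => ?_⟩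
  obtain ⟨φ, ⟨K, hK⟩, hb, hv⟩ := stepLip a h hh (fun k => (ψ k : ℝ)) C hC δ h1 h2
  have hm : Measurable φ := hK.continuous.measurable
  have hmeas : ∀ ε : ℝ, Measurable (fun x : Fin n → ℝ => Function.update x i (x i + ε * φ (x j))) := by
    intro ε
    rw [measurable_pi_iff]
    intro k
    by_cases hk : k = i
    · subst hk
      simp only [Function.update_self]
      fun_prop
    · simp only [Function.update_of_ne hk]
      fun_prop
  let g : (Fin n → ℝ) ≃ᵐ (Fin n → ℝ) :=
    { toFun := fun x => Function.update x i (x i + h * φ (x j))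
      invFun := fun x => Function.update x i (x i + (-h) * φ (x j))
      left_inv := by
        intro x
        simp [Function.update_of_ne hij]
      right_inv := by
        intro x
        simp [Function.update_of_ne hij]
      measurable_toFun := hmeas h
      measurable_invFun := hmeas (-h) }
  have hg : ∀ x, g x = Function.update x i (x i + h * φ (x j)) := fun x => rfl
  refine ⟨g, ⟨g.measurable, ?_⟩, ?_, ?_, ?_⟩
  · refine Measure.ext_of_lintegral _ ?_
    intro F hF
    rw [lintegral_map hF g.measurable]
    rw [volume_pi]
    apply lintegral_eq_of_lmarginal_eq {i} (hF.comp g.measurable) hF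
    rw [lmarginal_singleton, lmarginal_singleton]
    funext x
    simp only [Function.comp_apply, hg, Function.update_of_ne hij, Function.update_self,
      Function.update_idem]
    exact lintegral_add_right_eq_self (fun t => F (Function.update x i t)) (h * φ (x j))
  · refine ⟨1 + (Real.toNNReal h) * K, ?_⟩
    apply LipschitzWith.of_dist_le_mul
    intro x y
    have hx : ∀ k, dist (x k) (y k) ≤ dist x y := fun k => dist_le_pi_dist x y k
    rw [dist_pi_le_iff (by positivity)]
    intro k
    simp only [hg]
    have e1 : ((1 + Real.toNNReal h * K : NNReal) : ℝ) = 1 + h * K := by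
      simp [Real.coe_toNNReal _ hh.le]
    rw [e1]
    by_cases hk : k = i
    · subst hk
      simp only [Function.update_self]
      have h5 : dist (φ (x j)) (φ (y j)) ≤ K * dist x y :=
        (hK.dist_le_mul _ _).trans (by gcongr; exact hx j)
      have h6 := hx k
      rw [Real.dist_eq] at *
      have : x k + h * φ (x j) - (y k + h * φ (y j)) = (x k - y k) + h * (φ (x j) - φ (y j)) := by ring
      rw [this]
      calc _ ≤ |x k - y k| + h * |φ (x j) - φ (y j)| := by
            refine (abs_add_le _ _).trans ?_
            rw [abs_mul, abs_of_pos hh]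
        _ ≤ dist x y + h * (K * dist x y) := by gcongr
        _ = _ := by ring
    · simp only [Function.update_of_ne hk]
      refine (hx k).trans ?_
      have : 0 ≤ h * K * dist x y := by positivity
      linarith
  · intro x
    rw [pi_norm_le_iff_of_nonneg (by positivity)]
    intro k
    simp only [hg, Pi.sub_apply]
    by_cases hk : k = i
    · subst hk
      simp only [Function.update_self, add_sub_cancel_left, Real.norm_eq_abs, abs_mul, abs_of_pos hh]
      gcongr
      exact hb _
    · simp only [Function.update_of_ne hk, sub_self, norm_zero]
      positivity
  · intro P y hy
    funext k
    simp only [hg]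
    rw [hv (P j) (y j) (hy j)]
    by_cases hk : k = i
    · subst hk
      simp only [Function.update_self]
      push_cast
      ring
    · simp only [Function.update_of_ne hk]

theorem Rz_gather {n : ℕ} (a h : ℝ) (hh : 0 < h) (i : Fin n) (ψ : Fin n → ℤ → ℤ)
    (hψ : ∀ j, ∃ C : ℝ, ∀ k, |(ψ j k : ℝ)| ≤ C) (s : Finset (Fin n)) (hs : i ∉ s) :
    Rz a h (fun P => Function.update P i (P i + ∑ j ∈ s, ψ j (P j))) := by
  induction s using Finset.induction_on with
  | empty => simpa using Rz_id a h
  | insert j s hj ih =>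
    have hi : i ∉ s := fun h => hs (Finset.mem_insert_of_mem h)
    have hji : j ≠ i := fun h => hs (h ▸ Finset.mem_insert_self _ _)
    convert Rz_comp (Rz_shear a h hh i j hji (ψ j) (hψ j)) (ih hi) using 2 with P
    simp only [Function.update_self, Function.update_idem, Function.update_of_ne hji,
      Finset.sum_insert hj]
    congr 1
    ring

theorem Rz_scatter {n : ℕ} (a h : ℝ) (hh : 0 < h) (i : Fin n) (ψ : Fin n → ℤ → ℤ)
    (hψ : ∀ j, ∃ C : ℝ, ∀ k, |(ψ j k : ℝ)| ≤ C) (s : Finset (Fin n)) (hs : i ∉ s) :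
    Rz a h (fun P => fun k => if k ∈ s then P k + ψ k (P i) else P k) := by
  induction s using Finset.induction_on with
  | empty => simpa using Rz_id a h
  | insert j s hj ih =>
    have hi : i ∉ s := fun h => hs (Finset.mem_insert_of_mem h)
    have hji : i ≠ j := fun h => hs (h ▸ Finset.mem_insert_self _ _)
    convert Rz_comp (Rz_shear a h hh j i hji (ψ j) (hψ j)) (ih hi) using 2 with P
    funext k
    by_cases hk : k = j
    · subst hk
      simp [hj, hi]
    · simp [hk]

theorem ext_bdd {α : Type*} [Finite α] (c : α → ℤ) (F : α → ℤ) :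
    ∃ C : ℝ, ∀ k, |((Function.extend c F 0 k : ℤ) : ℝ)| ≤ C := by
  classical
  obtain ⟨C, hC⟩ := (Set.finite_range (fun p => |(F p : ℝ)|)).bddAbove
  refine ⟨max C 0, fun k => ?_⟩
  by_cases h : ∃ p, c p = k
  · rw [Function.extend_def, dif_pos h]
    exact le_max_of_le_left (hC ⟨_, rfl⟩)
  · rw [Function.extend_apply' _ _ _ h]
    simp

theorem Rz_perm {n M : ℕ} (hn : 2 ≤ n) (a h : ℝ) (hh : 0 < h)
    (τ : Equiv.Perm (Fin n → Fin M)) :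
    ∃ t, Rz a h t ∧ ∀ p : Fin n → Fin M,
      t (fun i => ((p i : ℕ) : ℤ)) = fun i => ((τ p i : ℕ) : ℤ) := by
  set i0 : Fin n := ⟨0, by omega⟩ with hi0
  set i1 : Fin n := ⟨1, by omega⟩ with hi1
  have h10 : i1 ≠ i0 := by simp [hi0, hi1]
  set c : (Fin n → Fin M) → ℤ := fun p => ∑ j, ((p j : ℕ) : ℤ) * (M : ℤ)^(j : ℕ) with hc
  have hcinj : Function.Injective c := by
    intro p q hpq
    apply finFunctionFinEquiv.injective
    apply Fin.ext
    rw [finFunctionFinEquiv_apply, finFunctionFinEquiv_apply]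
    have hpq' : ((∑ j, (p j : ℕ) * M ^ (j:ℕ) : ℕ) : ℤ) = ((∑ j, (q j : ℕ) * M ^ (j:ℕ) : ℕ) : ℤ) := by
      push_cast
      exact hpq
    exact_mod_cast hpq'
  have hvinj : Function.Injective (fun b : Fin M => ((b : ℕ) : ℤ)) := by
    intro b b' hb
    apply Fin.ext
    have hb' : ((b : ℕ) : ℤ) = ((b' : ℕ) : ℤ) := hb
    exact_mod_cast hb'
  have hc0 : ∀ p, c p = ((p i0 : ℕ) : ℤ) + ∑ j ∈ Finset.univ.erase i0, ((p j : ℕ) : ℤ) * (M : ℤ)^(j : ℕ) := by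
    intro p
    rw [hc]
    simp only
    rw [← Finset.add_sum_erase _ _ (Finset.mem_univ i0)]
    simp [hi0]
  obtain ⟨T1, hT1, t1⟩ : ∃ T, (∀ P, T P = Function.update P i0 (P i0 + ∑ j ∈ Finset.univ.erase i0,
      Function.extend (fun b : Fin M => ((b : ℕ) : ℤ))
        (fun b => ((b : ℕ) : ℤ) * (M : ℤ)^(j : ℕ)) 0 (P j))) ∧ Rz a h T :=
    ⟨_, fun _ => rfl, Rz_gather a h hh i0 (fun j => Function.extend _ _ 0) (fun j => ext_bdd _ _)
      (Finset.univ.erase i0) (by simp)⟩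
  obtain ⟨T2, hT2, t2⟩ : ∃ T, (∀ P, T P = fun k => if k ∈ Finset.univ.erase i0 then
      P k + Function.extend c
        (fun p => (if k = i1 then c (τ p) else ((τ p k : ℕ) : ℤ)) - ((p k : ℕ) : ℤ)) 0 (P i0)
      else P k) ∧ Rz a h T :=
    ⟨_, fun _ => rfl, Rz_scatter a h hh i0 (fun k => Function.extend c
      (fun p => (if k = i1 then c (τ p) else ((τ p k : ℕ) : ℤ)) - ((p k : ℕ) : ℤ)) 0)
      (fun j => ext_bdd _ _) (Finset.univ.erase i0) (by simp)⟩
  obtain ⟨T3, hT3, t3⟩ : ∃ T, (∀ P, T P = Function.update P i0 (P i0 +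
      Function.extend c (fun q => c q - c (τ.symm q)) 0 (P i1))) ∧ Rz a h T :=
    ⟨_, fun _ => rfl, Rz_shear a h hh i0 i1 h10 _ (ext_bdd _ _)⟩
  obtain ⟨T4, hT4, t4⟩ : ∃ T, (∀ P, T P = Function.update P i1 (P i1 +
      Function.extend c (fun q => ((q i1 : ℕ) : ℤ) - c q) 0 (P i0))) ∧ Rz a h T :=
    ⟨_, fun _ => rfl, Rz_shear a h hh i1 i0 h10.symm _ (ext_bdd _ _)⟩
  obtain ⟨T5, hT5, t5⟩ : ∃ T, (∀ P, T P = Function.update P i0 (P i0 + ∑ j ∈ Finset.univ.erase i0,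
      Function.extend (fun b : Fin M => ((b : ℕ) : ℤ))
        (fun b => -(((b : ℕ) : ℤ) * (M : ℤ)^(j : ℕ))) 0 (P j))) ∧ Rz a h T :=
    ⟨_, fun _ => rfl, Rz_gather a h hh i0 (fun j => Function.extend _ _ 0) (fun j => ext_bdd _ _)
      (Finset.univ.erase i0) (by simp)⟩
  refine ⟨_, Rz_comp t5 (Rz_comp t4 (Rz_comp t3 (Rz_comp t2 t1))), ?_⟩
  intro p
  have e1 : T1 (fun i => ((p i : ℕ) : ℤ)) = fun k => if k = i0 then c p else ((p k : ℕ) : ℤ) := by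
    rw [hT1]
    funext k
    by_cases hk : k = i0
    · subst hk
      simp only [Function.update_self, if_true]
      rw [hc0]
      congr 1
      apply Finset.sum_congr rfl
      intro j _
      exact hvinj.extend_apply _ _ (p j)
    · simp [hk]
  have e2 : T2 (fun k => if k = i0 then c p else ((p k : ℕ) : ℤ))
      = fun k => if k = i0 then c p else if k = i1 then c (τ p) else ((τ p k : ℕ) : ℤ) := by
    rw [hT2]
    funext k
    by_cases hk : k = i0
    · simp [hk]
    · simp only [Finset.mem_erase, hk, Finset.mem_univ, if_true, if_false, and_true,
        not_false_eq_true, ne_eq]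
      rw [hcinj.extend_apply]
      ring
  have e3 : T3 (fun k => if k = i0 then c p else if k = i1 then c (τ p) else ((τ p k : ℕ) : ℤ))
      = fun k => if k = i0 then c (τ p) else if k = i1 then c (τ p) else ((τ p k : ℕ) : ℤ) := by
    rw [hT3]
    funext k
    by_cases hk : k = i0
    · subst hk
      simp only [Function.update_self, if_true, h10, if_false]
      rw [hcinj.extend_apply]
      simp
    · simp [hk]
  have e4 : T4 (fun k => if k = i0 then c (τ p) else if k = i1 then c (τ p)
        else ((τ p k : ℕ) : ℤ))
      = fun k => if k = i0 then c (τ p) else ((τ p k : ℕ) : ℤ) := by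
    rw [hT4]
    funext k
    by_cases hk : k = i1
    · subst hk
      simp only [Function.update_self, if_true, h10, if_false]
      rw [hcinj.extend_apply]
      simp
    · simp [hk]
  have e5 : T5 (fun k => if k = i0 then c (τ p) else ((τ p k : ℕ) : ℤ))
      = fun i => ((τ p i : ℕ) : ℤ) := by
    rw [hT5]
    funext k
    by_cases hk : k = i0
    · subst hk
      simp only [Function.update_self, if_true]
      rw [hc0, add_assoc, ← Finset.sum_add_distrib, Finset.sum_eq_zero, add_zero]
      intro j hj
      rw [if_neg (Finset.ne_of_mem_erase hj), hvinj.extend_apply _ _ (τ p j)]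
      ring
    · simp [hk]
  rw [e1, e2, e3, e4, e5]

theorem minCost {I : Type*} [Fintype I] [DecidableEq I] (A C : I → I → ℝ)
    (hA : ∀ p r, 0 ≤ A p r) (hrow : ∀ p, ∑ r, A p r ≤ 1) (hcol : ∀ r, ∑ p, A p r ≤ 1)
    (hC : ∀ p, ∑ r, A p r ≠ 1 → ∀ r, C p r = 0) :
    ∃ τ : Equiv.Perm I, ∑ p, C p (τ p) ≤ ∑ p, ∑ r, A p r * C p r := by
  set ρ : I → ℝ := fun p => 1 - ∑ r, A p r with hρ
  set κ : I → ℝ := fun r => 1 - ∑ p, A p r with hκ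
  set t : ℝ := ∑ p, ρ p with ht
  have hρ0 : ∀ p, 0 ≤ ρ p := fun p => by simp only [hρ]; linarith [hrow p]
  have hκ0 : ∀ p, 0 ≤ κ p := fun p => by simp only [hκ]; linarith [hcol p]
  have htκ : ∑ r, κ r = t := by
    simp only [ht, hρ, hκ, Finset.sum_sub_distrib]
    rw [Finset.sum_comm]
  have ht0 : 0 ≤ t := Finset.sum_nonneg fun p _ => hρ0 p
  have hρt : ∀ p, ρ p * t / t = ρ p := by
    intro p
    rcases eq_or_lt_of_le ht0 with h | h
    · have : ρ p = 0 := (Finset.sum_eq_zero_iff_of_nonneg (fun p _ => hρ0 p)).1 h.symm p (Finset.mem_univ _)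
      simp [this]
    · field_simp
  have hκt : ∀ p, κ p * t / t = κ p := by
    intro p
    rcases eq_or_lt_of_le ht0 with h | h
    · have : κ p = 0 := (Finset.sum_eq_zero_iff_of_nonneg (fun p _ => hκ0 p)).1 (htκ.trans h.symm) p (Finset.mem_univ _)
      simp [this]
    · field_simp
  set B : Matrix I I ℝ := Matrix.of fun p r => A p r + ρ p * κ r / t with hB
  have hBd : B ∈ doublyStochastic ℝ I := by
    rw [mem_doublyStochastic_iff_sum]
    refine ⟨?_, ?_, ?_⟩
    · intro i j
      simp only [hB, Matrix.of_apply]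
      have := hA i j
      have := hρ0 i
      have := hκ0 j
      positivity
    · intro i
      simp only [hB, Matrix.of_apply, Finset.sum_add_distrib]
      rw [← Finset.sum_div, ← Finset.mul_sum, htκ, hρt]
      simp [hρ]
    · intro j
      simp only [hB, Matrix.of_apply, Finset.sum_add_distrib]
      rw [← Finset.sum_div, ← Finset.sum_mul, ← ht, mul_comm, hκt]
      simp [hκ]
  obtain ⟨W, hW0, hW1, hW⟩ := exists_eq_sum_perm_of_mem_doublyStochastic hBd
  by_contra hcon
  push Not at hcon
  have key : ∑ p, ∑ r, B p r * C p r = ∑ p, ∑ r, A p r * C p r := by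
    apply Finset.sum_congr rfl
    intro p _
    apply Finset.sum_congr rfl
    intro r _
    by_cases h : ∑ r, A p r = 1
    · simp [hB, hρ, h]
    · simp [hC p h r]
  have key2 : ∑ p, ∑ r, B p r * C p r = ∑ τ : Equiv.Perm I, W τ * ∑ p, C p (τ p) := by
    rw [← hW]
    simp only [Matrix.sum_apply, Matrix.smul_apply, smul_eq_mul, Finset.sum_mul]
    have : ∀ p : I, ∑ r, ∑ τ : Equiv.Perm I, W τ * (τ.permMatrix ℝ) p r * C p r
        = ∑ τ : Equiv.Perm I, W τ * C p (τ p) := by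
      intro p
      rw [Finset.sum_comm]
      apply Finset.sum_congr rfl
      intro τ _
      simp [Equiv.Perm.permMatrix, PEquiv.toMatrix_apply]
    simp only [this]
    rw [Finset.sum_comm]
    simp only [Finset.mul_sum]
  have : ∑ τ : Equiv.Perm I, W τ * (∑ p, ∑ r, A p r * C p r) < ∑ τ : Equiv.Perm I, W τ * ∑ p, C p (τ p) := by
    apply Finset.sum_lt_sum
    · intro τ _
      exact mul_le_mul_of_nonneg_left (hcon τ).le (hW0 τ)
    · by_contra hh
      push Not at hh
      have : ∀ τ, W τ = 0 := by
        intro τ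
        by_contra hne
        have hpos : 0 < W τ := lt_of_le_of_ne (hW0 τ) (Ne.symm hne)
        have := hh τ (Finset.mem_univ _)
        nlinarith [hcon τ]
      simp [this] at hW1
  rw [← Finset.sum_mul, hW1, one_mul, ← key, key2] at this
  exact lt_irrefl _ this

/-- grid cells -/
def gcell {n M : ℕ} (a h : ℝ) (p : Fin n → Fin M) : Set (Fin n → ℝ) :=
  Set.pi univ (fun i => Ico (a + h * ((p i : ℕ) : ℝ)) (a + h * (((p i : ℕ) : ℝ) + 1)))

theorem gcell_meas {n M : ℕ} (a h : ℝ) (p : Fin n → Fin M) : MeasurableSet (gcell a h p) :=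
  MeasurableSet.univ_pi fun _ => measurableSet_Ico

theorem gcell_vol {n M : ℕ} (a h : ℝ) (p : Fin n → Fin M) :
    volume (gcell a h p) = ENNReal.ofReal h ^ n := by
  rw [gcell, Real.volume_pi_Ico]
  have : ∀ i, a + h * (((p i : ℕ) : ℝ) + 1) - (a + h * ((p i : ℕ) : ℝ)) = h := fun i => by ring
  simp [this]

theorem gcell_disj {n M : ℕ} (a h : ℝ) (hh : 0 < h) :
    Pairwise (Function.onFun Disjoint (gcell (n := n) (M := M) a h)) := by
  intro p q hpq
  rw [Function.onFun, Set.disjoint_left]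
  intro x hx hx'
  apply hpq
  funext i
  apply Fin.ext
  have h1 := hx i (mem_univ i)
  have h2 := hx' i (mem_univ i)
  simp only [mem_Ico] at h1 h2
  have e1 : ((p i : ℕ) : ℝ) < ((q i : ℕ) : ℝ) + 1 := by
    by_contra hc
    push Not at hc
    nlinarith
  have e2 : ((q i : ℕ) : ℝ) < ((p i : ℕ) : ℝ) + 1 := by
    by_contra hc
    push Not at hc
    nlinarith
  have e1' : (p i : ℕ) < (q i : ℕ) + 1 := by exact_mod_cast e1
  have e2' : (q i : ℕ) < (p i : ℕ) + 1 := by exact_mod_cast e2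
  omega

theorem gcell_cover {n M : ℕ} (a h b : ℝ) (hh : 0 < h) (hM : a + h * M = b) (x : Fin n → ℝ)
    (hx : ∀ i, x i ∈ Ico a b) : ∃ p : Fin n → Fin M, x ∈ gcell a h p := by
  have : ∀ i, ∃ k : Fin M, x i ∈ Ico (a + h * ((k : ℕ) : ℝ)) (a + h * (((k : ℕ) : ℝ) + 1)) := by
    intro i
    have hi := hx i
    have h0 : 0 ≤ (x i - a)/h := div_nonneg (by linarith [hi.1]) hh.le
    have hlt : ⌊(x i - a)/h⌋₊ < M := by
      rw [Nat.floor_lt h0, div_lt_iff₀ hh]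
      linarith [hi.2]
    refine ⟨⟨⌊(x i - a)/h⌋₊, hlt⟩, ?_⟩
    have e1 := Nat.floor_le h0
    have e2 := Nat.lt_floor_add_one ((x i - a)/h)
    rw [le_div_iff₀ hh] at e1
    rw [div_lt_iff₀ hh] at e2
    simp only [mem_Ico]
    constructor <;> linarith
  choose k hk using this
  exact ⟨k, fun i _ => hk i⟩

theorem gcell_dist {n M : ℕ} (a h : ℝ) (hh : 0 < h) (p : Fin n → Fin M) {x y : Fin n → ℝ}
    (hx : x ∈ gcell a h p) (hy : y ∈ gcell a h p) : ‖x - y‖ ≤ h := by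
  rw [pi_norm_le_iff_of_nonneg hh.le]
  intro i
  have h1 := hx i (mem_univ i)
  have h2 := hy i (mem_univ i)
  simp only [mem_Ico] at h1 h2
  rw [Pi.sub_apply, Real.norm_eq_abs, abs_le]
  constructor <;> nlinarith

/-- shrunk cells -/
def gshr {n M : ℕ} (a h δ : ℝ) (p : Fin n → Fin M) : Set (Fin n → ℝ) :=
  Icc (fun i => a + h * (((p i : ℕ) : ℝ) + δ)) (fun i => a + h * (((p i : ℕ) : ℝ) + (1 - δ)))

theorem gshr_sub {n M : ℕ} (a h δ : ℝ) (hh : 0 < h) (hδ : 0 < δ) (p : Fin n → Fin M) :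
    gshr a h δ p ⊆ gcell a h p := by
  intro x hx i _
  have h1 := hx.1 i
  have h2 := hx.2 i
  simp only at h1 h2
  simp only [mem_Ico]
  constructor <;> nlinarith

theorem gshr_vol {n M : ℕ} (a h δ : ℝ) (p : Fin n → Fin M) :
    volume (gshr a h δ p) = ENNReal.ofReal (h * (1 - 2 * δ)) ^ n := by
  rw [gshr, Real.volume_Icc_pi]
  have : ∀ i, a + h * (((p i : ℕ) : ℝ) + (1 - δ)) - (a + h * (((p i : ℕ) : ℝ) + δ)) = h * (1 - 2 * δ) :=
    fun i => by ring
  simp [this]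

theorem gap_small {n M : ℕ} (a h : ℝ) (hh : 0 < h) (c ε : ENNReal) (hc : c ≠ ⊤) (hε : ε ≠ 0) :
    ∃ δ : ℝ, 0 < δ ∧ δ < 1/2 ∧ ∀ p : Fin n → Fin M,
      c * volume (gcell a h p \ gshr a h δ p) ≤ ε := by
  have ht : Filter.Tendsto (fun δ : ℝ => c * ENNReal.ofReal (h^n - (h * (1 - 2 * δ))^n)) (nhdsWithin 0 (Ioi 0)) (nhds 0) := by
    have h1 : Filter.Tendsto (fun δ : ℝ => h^n - (h * (1 - 2 * δ))^n) (nhdsWithin 0 (Ioi 0)) (nhds 0) := by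
      have : Continuous (fun δ : ℝ => h^n - (h * (1 - 2 * δ))^n) := by fun_prop
      have h2 := this.tendsto 0
      simp only [mul_zero, sub_zero, mul_one, sub_self] at h2
      exact h2.mono_left nhdsWithin_le_nhds
    have h2 := (ENNReal.continuous_ofReal.tendsto 0).comp h1
    rw [ENNReal.ofReal_zero] at h2
    have h3 := ENNReal.Tendsto.const_mul h2 (Or.inr hc)
    simpa using h3
  have he : ∀ᶠ δ in nhdsWithin (0:ℝ) (Ioi 0), δ < 1/2 :=
    nhdsWithin_le_nhds (Iio_mem_nhds (by norm_num))
  obtain ⟨δ, ⟨h1, h2⟩, h3⟩ := ((((tendsto_order.1 ht).2 ε (pos_iff_ne_zero.2 hε)).and he).and self_mem_nhdsWithin).exists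
  have hδ : 0 < δ := h3
  refine ⟨δ, hδ, h2, fun p => ?_⟩
  rw [measure_sdiff (gshr_sub a h δ hh hδ p) measurableSet_Icc.nullMeasurableSet (by rw [gshr_vol]; simp),
    gcell_vol, gshr_vol, ← ENNReal.ofReal_pow hh.le, ← ENNReal.ofReal_pow, ← ENNReal.ofReal_sub]
  · exact h1.le
  · apply pow_nonneg
    nlinarith
  · nlinarith

theorem bad_tendsto {n : ℕ} (U : Set (Fin n → ℝ)) (hUo : IsOpen U) (hfin : volume U ≠ ⊤) (R : ℝ) (hR : 0 < R) :
    Filter.Tendsto (fun M : ℕ => volume (U ∩ {x | Metric.infEDist x Uᶜ ≤ ENNReal.ofReal (R / (M + 1 : ℕ))}))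
      Filter.atTop (nhds 0) := by
  have hm : ∀ M : ℕ, MeasurableSet (U ∩ {x | Metric.infEDist x Uᶜ ≤ ENNReal.ofReal (R / (M + 1 : ℕ))}) := by
    intro M
    exact hUo.measurableSet.inter (measurableSet_le measurable_infEDist measurable_const)
  have := tendsto_measure_iInter_atTop (μ := volume) (fun M => (hm M).nullMeasurableSet) (by
    intro M M' hMM
    apply inter_subset_inter_right
    intro x hx
    refine le_trans hx (ENNReal.ofReal_le_ofReal ?_)
    gcongr) ⟨0, ne_top_of_le_ne_top hfin (measure_mono inter_subset_left)⟩
  suffices hempty : (⋂ M : ℕ, U ∩ {x | Metric.infEDist x Uᶜ ≤ ENNReal.ofReal (R / (M + 1 : ℕ))}) = ∅ by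
    rw [hempty, measure_empty] at this
    exact this
  rw [eq_empty_iff_forall_notMem]
  intro x hx
  rw [mem_iInter] at hx
  have hxU := (hx 0).1
  have hpos : 0 < Metric.infEDist x Uᶜ := by
    rw [Metric.infEDist_pos_iff_notMem_closure, hUo.isClosed_compl.closure_eq]
    simpa using hxU
  have ht : Filter.Tendsto (fun M : ℕ => ENNReal.ofReal (R / (M + 1 : ℕ))) Filter.atTop (nhds 0) := by
    rw [← ENNReal.ofReal_zero]
    apply (ENNReal.continuous_ofReal.tendsto 0).comp
    exact (tendsto_const_div_atTop_nhds_zero_nat R).comp (Filter.tendsto_add_atTop_nat 1)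
  obtain ⟨M, hM⟩ := ((tendsto_order.1 ht).2 _ hpos).exists
  exact absurd (hx M).2 (not_le.2 hM)

theorem add_rpow_two (p : ℝ) (hp : 1 < p) (a b : ENNReal) :
    (a + b) ^ p ≤ 2 ^ p * (a ^ p + b ^ p) := by
  refine (ENNReal.rpow_add_le_mul_rpow_add_rpow a b hp.le).trans ?_
  gcongr
  · norm_num
  · linarith

/-- centre of a grid cell -/
def gctr {n M : ℕ} (a h : ℝ) (p : Fin n → Fin M) : Fin n → ℝ :=
  fun i => a + h * (((p i : ℕ) : ℝ) + 1 / 2)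

theorem gctr_mem {n M : ℕ} (a h : ℝ) (hh : 0 < h) (p : Fin n → Fin M) : gctr a h p ∈ gcell a h p := by
  intro i _
  simp only [gctr, mem_Ico]
  constructor <;> nlinarith

theorem sum_lint_le {α ι : Type*} [Fintype ι] [MeasurableSpace α] {μ : Measure α} (W : ι → Set α)
    (U : Set α) (F : α → ENNReal) (hW : ∀ i, MeasurableSet (W i))
    (hd : Pairwise (Function.onFun Disjoint W)) (hU : ∀ i, W i ⊆ U) :
    ∑ i, ∫⁻ x in W i, F x ∂μ ≤ ∫⁻ x in U, F x ∂μ := by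
  have : Countable ι := Finite.to_countable
  rw [← tsum_fintype (L := .unconditional _), ← lintegral_iUnion hW hd]
  exact lintegral_mono_set (iUnion_subset hU)

theorem sum_lint_le2 {α ι : Type*} [Fintype ι] [MeasurableSpace α] {μ : Measure α} (V : ι → ι → Set α)
    (U : Set α) (F : α → ENNReal) (hV : ∀ i j, MeasurableSet (V i j))
    (hd : ∀ i j i' j' x, x ∈ V i j → x ∈ V i' j' → i = i' ∧ j = j') (hU : ∀ i j, V i j ⊆ U) :
    ∑ i, ∑ j, ∫⁻ x in V i j, F x ∂μ ≤ ∫⁻ x in U, F x ∂μ := by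
  rw [← Fintype.sum_prod_type']
  refine sum_lint_le (fun z : ι × ι => V z.1 z.2) U F (fun z => hV z.1 z.2) ?_ (fun z => hU z.1 z.2)
  intro z z' hzz
  rw [Function.onFun, Set.disjoint_left]
  intro x hx hx'
  exact hzz (Prod.ext (hd _ _ _ _ x hx hx').1 (hd _ _ _ _ x hx hx').2)

set_option maxHeartbeats 1000000 in
theorem gridCost {n M : ℕ} (p : ℝ) (hp : 1 < p)
    (U : Set (Fin n → ℝ)) (hUo : IsOpen U) (R : ℝ)
    (hUR : ∀ x ∈ U, ∀ i, x i ∈ Ico (-R) R) (w σ : (Fin n → ℝ) → (Fin n → ℝ)) (K : NNReal)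
    (hw : LipschitzWith K w) (hσm : Measurable σ) (hσR : ∀ x ∈ U, ∀ i, σ x i ∈ Ico (-R) R)
    (hmap : Measure.map σ (volume.restrict U) ≤ volume) (h : ℝ) (hh : 0 < h) (hM : -R + h * M = R) :
    ∃ τ : Equiv.Perm (Fin n → Fin M), ∀ S : Finset (Fin n → Fin M),
      (∀ q, q ∈ S ↔ gcell (-R) h q ⊆ U) →
      ∑ q ∈ S, ‖w (gctr (-R) h q) - gctr (-R) h (τ q)‖ₑ ^ p * ENNReal.ofReal h ^ n ≤
        ∫⁻ x in U, (‖w x - σ x‖ₑ + ENNReal.ofReal ((K + 1) * h)) ^ p := by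
  classical
  set a := -R with ha
  have hn0 : 0 < h ^ n := pow_pos hh n
  set V : (Fin n → Fin M) → (Fin n → Fin M) → Set (Fin n → ℝ) :=
    fun q r => (gcell a h q ∩ U) ∩ σ ⁻¹' (gcell a h r) with hV
  have hVm : ∀ q r, MeasurableSet (V q r) := fun q r =>
    ((gcell_meas a h q).inter hUo.measurableSet).inter (hσm (gcell_meas a h r))
  have hVle : ∀ q r, volume (V q r) ≤ ENNReal.ofReal h ^ n := fun q r => by
    rw [← gcell_vol a h q]
    exact measure_mono (inter_subset_left.trans inter_subset_left)
  have hVfin : ∀ q r, volume (V q r) ≠ ⊤ := fun q r =>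
    ne_top_of_le_ne_top (by simp) (hVle q r)
  have hrow : ∀ q, ∑ r, volume (V q r) = volume (gcell a h q ∩ U) := by
    intro q
    rw [← tsum_fintype (L := .unconditional _), ← measure_iUnion (μ := volume) ?_ (hVm q)]
    · congr 1
      ext x
      simp only [hV, mem_iUnion, mem_inter_iff, mem_preimage]
      constructor
      · rintro ⟨r, hr, _⟩
        exact hr
      · intro hx
        obtain ⟨r, hr⟩ := gcell_cover a h R hh hM (σ x) (hσR x hx.2)
        exact ⟨r, hx, hr⟩
    · intro r r' hrr
      exact ((gcell_disj a h hh hrr).preimage σ).mono inter_subset_right inter_subset_right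
  have hcol : ∀ r, ∑ q, volume (V q r) ≤ ENNReal.ofReal h ^ n := by
    intro r
    rw [← tsum_fintype (L := .unconditional _), ← measure_iUnion (μ := volume) ?_ (fun q => hVm q r), ← gcell_vol a h r]
    · refine le_trans ?_ (hmap (gcell a h r))
      rw [Measure.map_apply hσm (gcell_meas a h r), Measure.restrict_apply (hσm (gcell_meas a h r))]
      apply measure_mono
      apply iUnion_subset
      intro q x hx
      exact ⟨hx.2, hx.1.2⟩
    · intro q q' hqq
      exact (gcell_disj a h hh hqq).mono (inter_subset_left.trans inter_subset_left) (inter_subset_left.trans inter_subset_left)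
  set A : (Fin n → Fin M) → (Fin n → Fin M) → ℝ := fun q r => (volume (V q r)).toReal / h ^ n with hA
  set C : (Fin n → Fin M) → (Fin n → Fin M) → ℝ := fun q r =>
    if gcell a h q ⊆ U then ‖w (gctr a h q) - gctr a h r‖ ^ p else 0 with hC
  have hC0 : ∀ q r, 0 ≤ C q r := by
    intro q r
    simp only [hC]
    split_ifs <;> positivity
  have hcv : (ENNReal.ofReal h ^ n).toReal = h ^ n := by
    rw [ENNReal.toReal_pow, ENNReal.toReal_ofReal hh.le]
  obtain ⟨τ, hτ⟩ := minCost A C (fun q r => by positivity) (by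
      intro q
      simp only [hA]
      rw [← Finset.sum_div, div_le_one hn0, ← ENNReal.toReal_sum (fun r _ => hVfin q r), hrow, ← hcv]
      apply ENNReal.toReal_mono (by simp)
      rw [← gcell_vol a h q]
      exact measure_mono inter_subset_left) (by
      intro r
      simp only [hA]
      rw [← Finset.sum_div, div_le_one hn0, ← ENNReal.toReal_sum (fun q _ => hVfin q r), ← hcv]
      exact ENNReal.toReal_mono (by simp) (hcol r)) (by
      intro q hq r
      simp only [hC]
      rw [if_neg]
      intro hsub
      apply hq
      simp only [hA]
      rw [← Finset.sum_div, ← ENNReal.toReal_sum (fun r _ => hVfin q r), hrow,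
        inter_eq_left.2 hsub, gcell_vol, hcv, div_self hn0.ne'])
  refine ⟨τ, fun S hS => ?_⟩
  have hpt : ∀ q r, ∀ x ∈ V q r, ‖w (gctr a h q) - gctr a h r‖ₑ ≤ ‖w x - σ x‖ₑ + ENNReal.ofReal ((K + 1) * h) := by
    intro q r x hx
    rw [← ofReal_norm, ← ofReal_norm, ← ENNReal.ofReal_add (norm_nonneg _) (by positivity)]
    apply ENNReal.ofReal_le_ofReal
    have h1 := gcell_dist a h hh q (gctr_mem a h hh q) hx.1.1
    have h2 := gcell_dist a h hh r hx.2 (gctr_mem a h hh r)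
    have h3 := hw.norm_sub_le (gctr a h q) x
    have h4 : ‖w (gctr a h q) - gctr a h r‖ ≤ ‖w (gctr a h q) - w x‖ + ‖w x - σ x‖ + ‖σ x - gctr a h r‖ := by
      have : w (gctr a h q) - gctr a h r = (w (gctr a h q) - w x) + (w x - σ x) + (σ x - gctr a h r) := by abel
      rw [this]
      exact norm_add₃_le
    have h5 : (K:ℝ) * ‖gctr a h q - x‖ ≤ K * h := by gcongr
    linarith
  have hof : ∀ q r, q ∈ S → ENNReal.ofReal (C q r) = ‖w (gctr a h q) - gctr a h r‖ₑ ^ p := by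
    intro q r hq
    simp only [hC]
    rw [if_pos ((hS q).1 hq), ← ENNReal.ofReal_rpow_of_nonneg (norm_nonneg _) (by linarith), ofReal_norm]
  calc ∑ q ∈ S, ‖w (gctr a h q) - gctr a h (τ q)‖ₑ ^ p * ENNReal.ofReal h ^ n
      = ∑ q ∈ S, ENNReal.ofReal (C q (τ q)) * ENNReal.ofReal h ^ n :=
        Finset.sum_congr rfl fun q hq => by rw [hof q _ hq]
    _ ≤ ∑ q, ENNReal.ofReal (C q (τ q)) * ENNReal.ofReal h ^ n :=
        Finset.sum_le_sum_of_subset (Finset.subset_univ S)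
    _ = ENNReal.ofReal (∑ q, C q (τ q)) * ENNReal.ofReal h ^ n := by
        rw [← Finset.sum_mul, ENNReal.ofReal_sum_of_nonneg fun q _ => hC0 q _]
    _ ≤ ENNReal.ofReal (∑ q, ∑ r, A q r * C q r) * ENNReal.ofReal h ^ n := by
        gcongr
    _ = ∑ q, ∑ r, volume (V q r) * ENNReal.ofReal (C q r) := by
        rw [ENNReal.ofReal_sum_of_nonneg fun q _ => Finset.sum_nonneg fun r _ => mul_nonneg (by positivity) (hC0 q r), Finset.sum_mul]
        refine Finset.sum_congr rfl fun q _ => ?_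
        rw [ENNReal.ofReal_sum_of_nonneg fun r _ => mul_nonneg (by positivity) (hC0 q r), Finset.sum_mul]
        refine Finset.sum_congr rfl fun r _ => ?_
        rw [← ENNReal.ofReal_pow hh.le, ← ENNReal.ofReal_mul (mul_nonneg (by positivity) (hC0 q r))]
        have : A q r * C q r * h ^ n = (volume (V q r)).toReal * C q r := by
          simp only [hA]; field_simp
        rw [this, ENNReal.ofReal_mul ENNReal.toReal_nonneg, ENNReal.ofReal_toReal (hVfin q r)]
    _ ≤ ∑ q, ∑ r, ∫⁻ x in V q r, (‖w x - σ x‖ₑ + ENNReal.ofReal ((K + 1) * h)) ^ p := by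
        refine Finset.sum_le_sum fun q _ => Finset.sum_le_sum fun r _ => ?_
        rw [mul_comm, ← setLIntegral_const]
        apply setLIntegral_mono' (hVm q r)
        intro x hx
        by_cases hq : q ∈ S
        · rw [hof q r hq]
          exact ENNReal.rpow_le_rpow (hpt q r x hx) (by linarith)
        · simp only [hC]
          rw [if_neg (fun hc => hq ((hS q).2 hc))]
          simp
    _ ≤ _ := by
        refine sum_lint_le2 V U _ hVm ?_ ?_
        · intro q r q' r' x hx hx'
          constructor
          · by_contra hne
            exact Set.disjoint_left.1 (gcell_disj a h hh hne) hx.1.1 hx'.1.1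
          · by_contra hne
            exact Set.disjoint_left.1 (gcell_disj a h hh hne) hx.2 hx'.2
        · intro q r x hx
          exact hx.1.2

theorem gcell_sub_box {n M : ℕ} (R h : ℝ) (hh : 0 < h) (hM : -R + h * M = R) (q : Fin n → Fin M)
    {x : Fin n → ℝ} (hx : x ∈ gcell (-R) h q) : ‖x‖ ≤ R := by
  have hR : 0 ≤ R := by
    have : 0 ≤ h * M := by positivity
    linarith
  rw [pi_norm_le_iff_of_nonneg hR]
  intro i
  have h1 := hx i (mem_univ i)
  simp only [mem_Ico] at h1
  have h2 : (((q i : ℕ) : ℝ) + 1) ≤ M := by exact_mod_cast (q i).2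
  have h3 : h * (((q i : ℕ) : ℝ) + 1) ≤ h * M := by gcongr
  have h4 : 0 ≤ h * ((q i : ℕ) : ℝ) := by positivity
  rw [Real.norm_eq_abs, abs_le]
  constructor <;> linarith

theorem gshr_map {n M : ℕ} (a h δ : ℝ) (hh : 0 < h) (hδ : 0 < δ) (g : (Fin n → ℝ) → (Fin n → ℝ))
    (t : (Fin n → ℤ) → (Fin n → ℤ)) (τ : Equiv.Perm (Fin n → Fin M))
    (ht : ∀ p : Fin n → Fin M, t (fun i => ((p i : ℕ) : ℤ)) = fun i => ((τ p i : ℕ) : ℤ))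
    (hg : ∀ (P : Fin n → ℤ) (y : Fin n → ℝ), (∀ i, y i ∈ Icc δ (1 - δ)) →
      g (fun i => a + h * (P i + y i)) = fun i => a + h * (t P i + y i))
    (q : Fin n → Fin M) {x : Fin n → ℝ} (hx : x ∈ gshr a h δ q) : g x ∈ gcell a h (τ q) := by
  have hy : ∀ i, (x i - a) / h - ((q i : ℕ) : ℝ) ∈ Icc δ (1 - δ) := by
    intro i
    have h1 := hx.1 i
    have h2 := hx.2 i
    simp only at h1 h2
    constructor
    · rw [le_sub_iff_add_le, le_div_iff₀ hh]
      linarith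
    · rw [sub_le_iff_le_add, div_le_iff₀ hh]
      linarith
  have := hg (fun i => ((q i : ℕ) : ℤ)) (fun i => (x i - a) / h - ((q i : ℕ) : ℝ)) hy
  have hxe : (fun i => a + h * ((((q i : ℕ) : ℤ) : ℝ) + ((x i - a) / h - ((q i : ℕ) : ℝ)))) = x := by
    funext i
    push_cast
    field_simp
    ring
  rw [hxe, ht] at this
  rw [this]
  intro i _
  have := hy i
  simp only [mem_Icc] at this
  simp only [mem_Ico, Int.cast_natCast]
  constructor <;> nlinarith [this.1, this.2]

set_option maxHeartbeats 1000000 in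
theorem lemM {n : ℕ} (hn : 2 ≤ n) (p : ℝ) (hp : 1 < p)
    (U : Set (Fin n → ℝ)) (hUo : IsOpen U) (R : ℝ) (hR : 0 < R)
    (hUR : ∀ x ∈ U, ∀ i, x i ∈ Ico (-R) R) (w σ : (Fin n → ℝ) → (Fin n → ℝ)) (K : NNReal)
    (hw : LipschitzWith K w) (Cw : ℝ) (hCw0 : 0 ≤ Cw) (hCw : ∀ x ∈ U, ‖w x‖ ≤ Cw)
    (hσm : Measurable σ) (hσR : ∀ x ∈ U, ∀ i, σ x i ∈ Ico (-R) R)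
    (hmap : Measure.map σ (volume.restrict U) ≤ volume) (ε : ENNReal) (hε : ε ≠ 0) :
    ∃ g : (Fin n → ℝ) ≃ᵐ (Fin n → ℝ), MeasurePreserving g volume volume ∧
      (∃ K', LipschitzWith K' g) ∧
      ∫⁻ x in U, ‖w x - g x‖ₑ ^ p ≤ 2 ^ p * 2 ^ p * (∫⁻ x in U, ‖w x - σ x‖ₑ ^ p) + ε := by
  classical
  have hp0 : 0 < p := by linarith
  have hUfin : volume U ≠ ⊤ := by
    have hsub : U ⊆ Icc (fun _ => -R) (fun _ => R) := fun x hx =>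
      ⟨fun i => (hUR x hx i).1, fun i => (hUR x hx i).2.le⟩
    exact ne_top_of_le_ne_top isCompact_Icc.measure_ne_top (measure_mono hsub)
  have h2p : (2 : ENNReal) ^ p ≠ ⊤ := ENNReal.rpow_ne_top_of_nonneg hp0.le (by simp)
  have hε3 : ε / 3 ≠ 0 := by simp [hε]
  have hbad := bad_tendsto U hUo hUfin (2 * R) (by linarith)
  have hbad2 := ENNReal.Tendsto.const_mul (a := ENNReal.ofReal (Cw + R) ^ p) hbad
    (Or.inr (ENNReal.rpow_ne_top_of_nonneg hp0.le (by simp)))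
  rw [mul_zero] at hbad2
  have herr : Filter.Tendsto (fun M : ℕ => (2 ^ p * 2 ^ p + 2 ^ p) *
      (ENNReal.ofReal ((K + 1) * ((2 * R) / (M + 1 : ℕ))) ^ p * volume U)) Filter.atTop (nhds 0) := by
    have h1 : Filter.Tendsto (fun M : ℕ => (K + 1) * ((2 * R) / (M + 1 : ℕ))) Filter.atTop (nhds (0 : ℝ)) := by
      rw [← mul_zero ((K : ℝ) + 1)]
      exact ((tendsto_const_div_atTop_nhds_zero_nat (2 * R)).comp (Filter.tendsto_add_atTop_nat 1)).const_mul _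
    have h2 := (ENNReal.continuous_ofReal.tendsto 0).comp h1
    have h3 := (ENNReal.continuous_rpow_const (y := p)).tendsto (ENNReal.ofReal 0) |>.comp h2
    have h4 := ENNReal.Tendsto.mul_const h3 (Or.inr hUfin)
    have h5 := ENNReal.Tendsto.const_mul (a := (2 : ENNReal) ^ p * 2 ^ p + 2 ^ p) h4
      (Or.inr (by simp [ENNReal.mul_eq_top, h2p]))
    simpa [ENNReal.zero_rpow_of_pos hp0] using h5
  obtain ⟨M0, hM1, hM2⟩ := (((tendsto_order.1 hbad2).2 _ (pos_iff_ne_zero.2 hε3)).and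
    ((tendsto_order.1 herr).2 _ (pos_iff_ne_zero.2 hε3))).exists
  set h : ℝ := (2 * R) / (M0 + 1 : ℕ) with hh_def
  have hh : 0 < h := by positivity
  have hM : -R + h * ((M0 + 1 : ℕ) : ℝ) = R := by
    rw [hh_def]; field_simp; ring
  obtain ⟨τ, hτ⟩ := gridCost p hp U hUo R hUR w σ K hw hσm hσR hmap h hh hM
  obtain ⟨t, ⟨D, hD⟩, ht⟩ := Rz_perm hn (-R) h hh τ
  have hD0 : 0 ≤ D := by
    obtain ⟨g, _, _, h3, _⟩ := hD (1/4) (by norm_num) (by norm_num)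
    exact (norm_nonneg _).trans (h3 0)
  have hcard : (Fintype.card (Fin n → Fin (M0 + 1)) : ENNReal) ≠ 0 := by simp
  obtain ⟨δ, hδ0, hδ1, hgap⟩ := gap_small (n := n) (M := M0 + 1) (-R) h hh
    (ENNReal.ofReal (Cw + R + D) ^ p) (ε / 3 / (Fintype.card (Fin n → Fin (M0 + 1)) : ENNReal))
    (ENNReal.rpow_ne_top_of_nonneg hp0.le (by simp)) (by
      rw [Ne, ENNReal.div_eq_zero_iff]
      push Not
      exact ⟨hε3, by simp⟩)
  obtain ⟨g, hg1, hg2, hg3, hg4⟩ := hD δ hδ0 hδ1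
  refine ⟨g, hg1, hg2, ?_⟩
  set S : Finset (Fin n → Fin (M0 + 1)) := Finset.univ.filter (fun q => gcell (-R) h q ⊆ U) with hS
  have hSiff : ∀ q, q ∈ S ↔ gcell (-R) h q ⊆ U := by simp [hS]
  set e : ENNReal := ENNReal.ofReal ((K + 1) * h) with he
  set bad : Set (Fin n → ℝ) := U ∩ {x | Metric.infEDist x Uᶜ ≤ ENNReal.ofReal h} with hbad_def
  have hbm : MeasurableSet bad := hUo.measurableSet.inter (measurableSet_le measurable_infEDist measurable_const)
  set F1 : (Fin n → ℝ) → ENNReal := fun x => ∑ q ∈ S, (gcell (-R) h q).indicator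
    (fun _ => 2 ^ p * (‖w (gctr (-R) h q) - gctr (-R) h (τ q)‖ₑ ^ p + e ^ p)) x with hF1
  set F2 : (Fin n → ℝ) → ENNReal := bad.indicator (fun _ => ENNReal.ofReal (Cw + R) ^ p) with hF2
  set F3 : (Fin n → ℝ) → ENNReal := fun x => ∑ q, (gcell (-R) h q \ gshr (-R) h δ q).indicator
    (fun _ => ENNReal.ofReal (Cw + R + D) ^ p) x with hF3
  have hpt : ∀ x ∈ U, ‖w x - g x‖ₑ ^ p ≤ F1 x + F2 x + F3 x := by
    intro x hxU
    obtain ⟨q, hq⟩ := gcell_cover (-R) h R hh hM x (hUR x hxU)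
    by_cases hs : x ∈ gshr (-R) h δ q
    · have hgx := gshr_map (-R) h δ hh hδ0 g t τ ht hg4 q hs
      by_cases hf : gcell (-R) h q ⊆ U
      · refine le_trans ?_ (le_trans (le_add_right le_rfl : F1 x ≤ F1 x + F2 x) (le_add_right le_rfl))
        refine le_trans ?_ (Finset.single_le_sum (f := fun q => (gcell (-R) h q).indicator
          (fun _ => 2 ^ p * (‖w (gctr (-R) h q) - gctr (-R) h (τ q)‖ₑ ^ p + e ^ p)) x) (fun _ _ => zero_le) ((hSiff q).2 hf))
        simp only [indicator_of_mem hq]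
        refine le_trans ?_ (add_rpow_two p hp _ _)
        apply ENNReal.rpow_le_rpow _ hp0.le
        rw [← ofReal_norm, ← ofReal_norm, he, ← ENNReal.ofReal_add (norm_nonneg _) (by positivity)]
        apply ENNReal.ofReal_le_ofReal
        have h1 := gcell_dist (-R) h hh q hq (gctr_mem (-R) h hh q)
        have h2 := gcell_dist (-R) h hh (τ q) (gctr_mem (-R) h hh (τ q)) hgx
        have h3 := hw.norm_sub_le x (gctr (-R) h q)
        have h4 : ‖w x - g x‖ ≤ ‖w x - w (gctr (-R) h q)‖ + ‖w (gctr (-R) h q) - gctr (-R) h (τ q)‖ + ‖gctr (-R) h (τ q) - g x‖ := by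
          have : w x - g x = (w x - w (gctr (-R) h q)) + (w (gctr (-R) h q) - gctr (-R) h (τ q)) + (gctr (-R) h (τ q) - g x) := by abel
          rw [this]
          exact norm_add₃_le
        have h5 : (K:ℝ) * ‖x - gctr (-R) h q‖ ≤ K * h := by gcongr
        linarith
      · refine le_trans ?_ (le_trans (le_add_left le_rfl : F2 x ≤ F1 x + F2 x) (le_add_right le_rfl))
        have hxb : x ∈ bad := by
          refine ⟨hxU, ?_⟩
          obtain ⟨y, hy, hyU⟩ := not_subset.1 hf
          refine (infEDist_le_edist_of_mem (show y ∈ Uᶜ from hyU)).trans ?_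
          rw [edist_dist, dist_eq_norm]
          exact ENNReal.ofReal_le_ofReal (gcell_dist (-R) h hh q hq hy)
        rw [hF2, indicator_of_mem hxb]
        apply ENNReal.rpow_le_rpow _ hp0.le
        rw [← ofReal_norm]
        apply ENNReal.ofReal_le_ofReal
        exact (norm_sub_le _ _).trans (add_le_add (hCw x hxU) (gcell_sub_box R h hh hM _ hgx))
    · refine le_trans ?_ (le_add_left le_rfl : F3 x ≤ F1 x + F2 x + F3 x)
      refine le_trans ?_ (Finset.single_le_sum (f := fun q => (gcell (-R) h q \ gshr (-R) h δ q).indicator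
        (fun _ => ENNReal.ofReal (Cw + R + D) ^ p) x) (fun _ _ => zero_le) (Finset.mem_univ q))
      have hxm : x ∈ gcell (-R) h q \ gshr (-R) h δ q := ⟨hq, hs⟩
      simp only [indicator_of_mem hxm]
      apply ENNReal.rpow_le_rpow _ hp0.le
      rw [← ofReal_norm]
      apply ENNReal.ofReal_le_ofReal
      have : w x - g x = w x - x - (g x - x) := by abel
      rw [this]
      refine (norm_sub_le _ _).trans (add_le_add ((norm_sub_le _ _).trans (add_le_add (hCw x hxU) ?_)) (hg3 x))
      exact gcell_sub_box R h hh hM q hq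
  have hF1m : Measurable F1 := Finset.measurable_sum _ fun q _ => measurable_const.indicator (gcell_meas _ _ q)
  have hF2m : Measurable F2 := measurable_const.indicator hbm
  have hF3m : Measurable F3 := Finset.measurable_sum _ fun q _ =>
    measurable_const.indicator ((gcell_meas _ _ q).diff measurableSet_Icc)
  have hI : ∫⁻ x in U, ‖w x - g x‖ₑ ^ p ≤ (∫⁻ x, F1 x) + (∫⁻ x, F2 x) + ∫⁻ x, F3 x := by
    rw [← lintegral_add_left hF1m, ← lintegral_add_left (show Measurable (fun a => F1 a + F2 a) from hF1m.add hF2m)]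
    exact (setLIntegral_mono' hUo.measurableSet hpt).trans (setLIntegral_le_lintegral _ _)
  have hgm : ∀ q : Fin n → Fin (M0 + 1), MeasurableSet (gcell (-R) h q \ gshr (-R) h δ q) := fun q =>
    (gcell_meas _ _ q).diff measurableSet_Icc
  have hI3 : ∫⁻ x, F3 x ≤ ε / 3 := by
    simp only [hF3]
    rw [lintegral_finsetSum _ fun q _ => measurable_const.indicator (hgm q)]
    calc _ ≤ ∑ q : Fin n → Fin (M0 + 1), (ε / 3 / (Fintype.card (Fin n → Fin (M0 + 1)) : ENNReal)) := by
          refine Finset.sum_le_sum fun q _ => ?_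
          rw [lintegral_indicator_const (hgm q)]
          exact hgap q
      _ = ε / 3 := by
          rw [Finset.sum_const, Finset.card_univ, nsmul_eq_mul, ENNReal.mul_div_cancel hcard (by simp)]
  have hI2 : ∫⁻ x, F2 x ≤ ε / 3 := by
    rw [hF2, lintegral_indicator_const hbm]
    exact hM1.le
  have hvolS : ∑ q ∈ S, ENNReal.ofReal h ^ n ≤ volume U := by
    calc ∑ q ∈ S, ENNReal.ofReal h ^ n = ∑ q ∈ S, volume (gcell (-R) h q) := by
          refine Finset.sum_congr rfl fun q _ => (gcell_vol _ _ _).symm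
      _ = volume (⋃ q ∈ S, gcell (-R) h q) := by
          rw [measure_biUnion_finset]
          · intro q _ q' _ hqq
            exact gcell_disj (-R) h hh hqq
          · intro q _
            exact gcell_meas _ _ q
      _ ≤ volume U := measure_mono (iUnion₂_subset fun q hq => (hSiff q).1 hq)
  have hI1 : ∫⁻ x, F1 x ≤ 2 ^ p * 2 ^ p * (∫⁻ x in U, ‖w x - σ x‖ₑ ^ p) + ε / 3 := by
    simp only [hF1]
    rw [lintegral_finsetSum _ fun q _ => measurable_const.indicator (gcell_meas _ _ q)]
    have hmm : Measurable fun x => ‖w x - σ x‖ₑ ^ p :=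
      ((hw.continuous.measurable.sub hσm).enorm).pow_const p
    calc _ = 2 ^ p * (∑ q ∈ S, ‖w (gctr (-R) h q) - gctr (-R) h (τ q)‖ₑ ^ p * ENNReal.ofReal h ^ n) + 2 ^ p * (e ^ p * ∑ q ∈ S, ENNReal.ofReal h ^ n) := by
          rw [Finset.mul_sum, Finset.mul_sum, Finset.mul_sum, ← Finset.sum_add_distrib]
          refine Finset.sum_congr rfl fun q _ => ?_
          rw [lintegral_indicator_const (gcell_meas _ _ q), gcell_vol]
          ring
      _ ≤ 2 ^ p * (∫⁻ x in U, (‖w x - σ x‖ₑ + e) ^ p) + 2 ^ p * (e ^ p * volume U) := by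
          gcongr
          exact hτ S hSiff
      _ ≤ 2 ^ p * (∫⁻ x in U, 2 ^ p * (‖w x - σ x‖ₑ ^ p + e ^ p)) + 2 ^ p * (e ^ p * volume U) := by
          gcongr with x
          exact add_rpow_two p hp _ _
      _ = 2 ^ p * 2 ^ p * (∫⁻ x in U, ‖w x - σ x‖ₑ ^ p) + (2 ^ p * 2 ^ p + 2 ^ p) * (e ^ p * volume U) := by
          rw [lintegral_const_mul _ (show Measurable (fun x => ‖w x - σ x‖ₑ ^ p + e ^ p) from hmm.add measurable_const), lintegral_add_left hmm, setLIntegral_const]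
          ring
      _ ≤ _ := by
          gcongr
  calc _ ≤ _ := hI
    _ ≤ (2 ^ p * 2 ^ p * (∫⁻ x in U, ‖w x - σ x‖ₑ ^ p) + ε / 3) + ε / 3 + ε / 3 := by gcongr
    _ = 2 ^ p * 2 ^ p * (∫⁻ x in U, ‖w x - σ x‖ₑ ^ p) + (ε / 3 + ε / 3 + ε / 3) := by ring
    _ = _ := by rw [ENNReal.add_thirds]

/-- mean of `g` over `[b, b+d]` -/
def knM (g : ℝ → ℝ) (b d : ℝ) : ℝ := (∫ s in b..(b + d), g s) / d

/-- one dimensional monotone rearrangement -/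
def knA (g : ℝ → ℝ) (b d t : ℝ) : ℝ := b + (∫ s in b..t, g s) / knM g b d

theorem kn_ii {g : ℝ → ℝ} (hg : Measurable g) {lo hi : ℝ} (hlo : 0 < lo) (h1 : ∀ t, lo ≤ g t)
    (h2 : ∀ t, g t ≤ hi) (a b : ℝ) : IntervalIntegrable g volume a b := by
  refine (intervalIntegrable_const (c := hi)).mono_fun' hg.aestronglyMeasurable ?_
  filter_upwards with t
  rw [Real.norm_of_nonneg (hlo.le.trans (h1 t))]
  exact h2 t

theorem knM_bd {g : ℝ → ℝ} (hg : Measurable g) {lo hi : ℝ} (hlo : 0 < lo) (h1 : ∀ t, lo ≤ g t)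
    (h2 : ∀ t, g t ≤ hi) (b d : ℝ) (hd : 0 < d) : lo ≤ knM g b d ∧ knM g b d ≤ hi := by
  have hi1 := kn_ii hg hlo h1 h2 b (b + d)
  rw [knM, le_div_iff₀ hd, div_le_iff₀ hd]
  constructor
  · have := intervalIntegral.integral_mono (μ := volume) (by linarith : b ≤ b + d) (intervalIntegrable_const (c := lo)) hi1 h1
    simpa [mul_comm] using this
  · have := intervalIntegral.integral_mono (μ := volume) (by linarith : b ≤ b + d) hi1 (intervalIntegrable_const (c := hi)) h2
    simpa [mul_comm] using this

theorem knA_sub {g : ℝ → ℝ} (hg : Measurable g) {lo hi : ℝ} (hlo : 0 < lo) (h1 : ∀ t, lo ≤ g t)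
    (h2 : ∀ t, g t ≤ hi) (b d s t : ℝ) : knA g b d t - knA g b d s = (∫ r in s..t, g r) / knM g b d := by
  rw [← intervalIntegral.integral_interval_sub_left (kn_ii hg hlo h1 h2 b t) (kn_ii hg hlo h1 h2 b s)]
  simp only [knA]
  ring

theorem knA_bds {g : ℝ → ℝ} (hg : Measurable g) {lo hi : ℝ} (hlo : 0 < lo) (h1 : ∀ t, lo ≤ g t)
    (h2 : ∀ t, g t ≤ hi) (b d : ℝ) (hd : 0 < d) {s t : ℝ} (hst : s ≤ t) :
    lo / hi * (t - s) ≤ knA g b d t - knA g b d s ∧ knA g b d t - knA g b d s ≤ hi / lo * (t - s) := by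
  have hi1 := kn_ii hg hlo h1 h2 s t
  have hM := knM_bd hg hlo h1 h2 b d hd
  have hM0 : 0 < knM g b d := hlo.trans_le hM.1
  have hhi : 0 < hi := hM0.trans_le hM.2
  have e1 := intervalIntegral.integral_mono (μ := volume) hst (intervalIntegrable_const (c := lo)) hi1 h1
  have e2 := intervalIntegral.integral_mono (μ := volume) hst hi1 (intervalIntegrable_const (c := hi)) h2
  simp only [intervalIntegral.integral_const, smul_eq_mul] at e1 e2
  rw [knA_sub hg hlo h1 h2]
  have hts : 0 ≤ t - s := by linarith
  constructor
  · calc lo / hi * (t - s) = ((t - s) * lo) / hi := by ring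
      _ ≤ (∫ r in s..t, g r) / hi := by gcongr
      _ ≤ _ := by
        apply div_le_div_of_nonneg_left _ hM0 hM.2
        exact (by positivity : 0 ≤ (t - s) * lo).trans e1
  · calc (∫ r in s..t, g r) / knM g b d ≤ ((t - s) * hi) / knM g b d := by gcongr
      _ ≤ ((t - s) * hi) / lo := by
        apply div_le_div_of_nonneg_left (by positivity) hlo hM.1
      _ = _ := by ring

theorem knA_strictMono {g : ℝ → ℝ} (hg : Measurable g) {lo hi : ℝ} (hlo : 0 < lo) (h1 : ∀ t, lo ≤ g t)
    (h2 : ∀ t, g t ≤ hi) (b d : ℝ) (hd : 0 < d) : StrictMono (knA g b d) := by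
  intro s t hst
  have := (knA_bds hg hlo h1 h2 b d hd hst.le).1
  have hhi : 0 < hi := hlo.trans_le ((h1 0).trans (h2 0))
  have : 0 < lo / hi * (t - s) := mul_pos (by positivity) (by linarith)
  linarith

theorem knA_lip {g : ℝ → ℝ} (hg : Measurable g) {lo hi : ℝ} (hlo : 0 < lo) (h1 : ∀ t, lo ≤ g t)
    (h2 : ∀ t, g t ≤ hi) (b d : ℝ) (hd : 0 < d) : LipschitzWith (hi / lo).toNNReal (knA g b d) := by
  have hhi : 0 < hi := hlo.trans_le ((h1 0).trans (h2 0))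
  apply LipschitzWith.of_dist_le_mul
  have key : ∀ s t, s ≤ t → dist (knA g b d s) (knA g b d t) ≤ (hi / lo).toNNReal * dist s t := by
    intro s t hst
    rw [dist_comm, dist_comm s, Real.dist_eq, Real.dist_eq, Real.coe_toNNReal _ (by positivity),
      abs_of_nonneg (by linarith : 0 ≤ t - s), abs_of_nonneg]
    · exact (knA_bds hg hlo h1 h2 b d hd hst).2
    · exact sub_nonneg.2 ((knA_strictMono hg hlo h1 h2 b d hd).monotone hst)
  intro s t
  rcases le_total s t with h | h
  · exact key s t h
  · rw [dist_comm, dist_comm s]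
    exact key t s h

theorem knA_left (g : ℝ → ℝ) (b d : ℝ) : knA g b d b = b := by simp [knA]

theorem knA_right {g : ℝ → ℝ} (hg : Measurable g) {lo hi : ℝ} (hlo : 0 < lo) (h1 : ∀ t, lo ≤ g t)
    (h2 : ∀ t, g t ≤ hi) (b d : ℝ) (hd : 0 < d) : knA g b d (b + d) = b + d := by
  have hM := knM_bd hg hlo h1 h2 b d hd
  have hM0 : 0 < knM g b d := hlo.trans_le hM.1
  have : (∫ s in b..(b + d), g s) = knM g b d * d := by rw [knM]; field_simp
  rw [knA, this]
  field_simp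

theorem knA_surj {g : ℝ → ℝ} (hg : Measurable g) {lo hi : ℝ} (hlo : 0 < lo) (h1 : ∀ t, lo ≤ g t)
    (h2 : ∀ t, g t ≤ hi) (b d : ℝ) (hd : 0 < d) : Function.Surjective (knA g b d) := by
  have hhi : 0 < hi := hlo.trans_le ((h1 0).trans (h2 0))
  have hc : 0 < lo / hi := by positivity
  apply (knA_lip hg hlo h1 h2 b d hd).continuous.surjective
  · have : Filter.Tendsto (fun t => lo / hi * t + (knA g b d 0)) Filter.atTop Filter.atTop :=
      Filter.tendsto_atTop_add_const_right _ _ (Filter.tendsto_id.const_mul_atTop hc)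
    refine Filter.tendsto_atTop_mono' _ ?_ this
    filter_upwards [Filter.eventually_ge_atTop 0] with t ht
    have := (knA_bds hg hlo h1 h2 b d hd ht).1
    simp only [sub_zero] at this
    linarith
  · have : Filter.Tendsto (fun t => lo / hi * t + (knA g b d 0)) Filter.atBot Filter.atBot :=
      Filter.tendsto_atBot_add_const_right _ _ (Filter.tendsto_id.const_mul_atBot hc)
    refine Filter.tendsto_atBot_mono' _ ?_ this
    filter_upwards [Filter.eventually_le_atBot 0] with t ht
    have := (knA_bds hg hlo h1 h2 b d hd ht).1
    simp only [zero_sub] at this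
    linarith

theorem knA_lint {g : ℝ → ℝ} (hg : Measurable g) {lo hi : ℝ} (hlo : 0 < lo) (h1 : ∀ t, lo ≤ g t)
    (h2 : ∀ t, g t ≤ hi) (b d : ℝ) (hd : 0 < d) (F : ℝ → ENNReal) (hF : Measurable F) :
    ∫⁻ t in Icc b (b + d), F (knA g b d t) * ENNReal.ofReal (g t) =
      ∫⁻ t in Icc b (b + d), F t * ENNReal.ofReal (knM g b d) := by
  have hM := knM_bd hg hlo h1 h2 b d hd
  have hM0 : 0 < knM g b d := hlo.trans_le hM.1
  have hsm := knA_strictMono hg hlo h1 h2 b d hd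
  have hc := (knA_lip hg hlo h1 h2 b d hd).continuous
  have hgo : Measurable fun t => ENNReal.ofReal (g t) := hg.ennreal_ofReal
  have key : ENNReal.ofReal (knM g b d) • (volume : Measure ℝ) =
      Measure.map (knA g b d) (volume.withDensity fun t => ENNReal.ofReal (g t)) := by
    have : IsLocallyFiniteMeasure (ENNReal.ofReal (knM g b d) • (volume : Measure ℝ)) :=
      inferInstanceAs (IsLocallyFiniteMeasure ((knM g b d).toNNReal • (volume : Measure ℝ)))
    apply Real.measure_ext_Ioo_rat
    intro x y
    obtain ⟨s, hs⟩ := knA_surj hg hlo h1 h2 b d hd x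
    obtain ⟨t, ht⟩ := knA_surj hg hlo h1 h2 b d hd y
    have hpre : knA g b d ⁻¹' Ioo (x:ℝ) y = Ioo s t := by
      ext z
      rw [mem_preimage, ← hs, ← ht, mem_Ioo, mem_Ioo, hsm.lt_iff_lt, hsm.lt_iff_lt]
    rw [Measure.map_apply hc.measurable measurableSet_Ioo, hpre, withDensity_apply _ measurableSet_Ioo,
      Measure.smul_apply, Real.volume_Ioo, smul_eq_mul, ← ENNReal.ofReal_mul hM0.le]
    rcases le_or_gt t s with hts | hst
    · rw [Ioo_eq_empty (not_lt.2 hts)]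
      have := hsm.monotone hts
      rw [hs, ht] at this
      simp only [Measure.restrict_empty, lintegral_zero_measure, ENNReal.ofReal_eq_zero]
      apply mul_nonpos_of_nonneg_of_nonpos hM0.le
      linarith
    · rw [← ofReal_integral_eq_lintegral_ofReal]
      · rw [← integral_Ioc_eq_integral_Ioo, ← intervalIntegral.integral_of_le hst.le]
        have := knA_sub hg hlo h1 h2 b d s t
        rw [hs, ht] at this
        rw [this]
        field_simp
      · exact ((intervalIntegrable_iff_integrableOn_Ioo_of_le hst.le).1 (kn_ii hg hlo h1 h2 s t))
      · filter_upwards with r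
        exact hlo.le.trans (h1 r)
  have hpre : ∀ t, knA g b d t ∈ Icc b (b + d) ↔ t ∈ Icc b (b + d) := by
    intro t
    conv_lhs => rw [← knA_right hg hlo h1 h2 b d hd]
    nth_rewrite 1 [← knA_left g b d]
    rw [mem_Icc, mem_Icc, hsm.le_iff_le, hsm.le_iff_le]
  have e1 : ∫⁻ t, (Icc b (b + d)).indicator F t ∂(ENNReal.ofReal (knM g b d) • (volume : Measure ℝ)) =
      ∫⁻ t in Icc b (b + d), F t * ENNReal.ofReal (knM g b d) := by
    rw [lintegral_smul_measure, lintegral_indicator measurableSet_Icc, lintegral_mul_const _ hF, mul_comm]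
    rfl
  rw [← e1, key, lintegral_map (hF.indicator measurableSet_Icc) hc.measurable,
    lintegral_withDensity_eq_lintegral_mul _ hgo
      (show Measurable (fun a => (Icc b (b + d)).indicator F (knA g b d a)) from (hF.indicator measurableSet_Icc).comp hc.measurable),
    ← lintegral_indicator measurableSet_Icc]
  apply lintegral_congr
  intro t
  by_cases ht : t ∈ Icc b (b + d)
  · simp only [Pi.mul_apply, indicator_of_mem ht, indicator_of_mem ((hpre t).2 ht)]
    rw [mul_comm]
  · simp only [Pi.mul_apply, indicator_of_notMem ht, indicator_of_notMem (fun h => ht ((hpre t).1 h)), mul_zero]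

theorem jensen_Icc (p : ℝ) (hp : 1 < p) (b d : ℝ) (F : ℝ → ENNReal) (hF : Measurable F) :
    (∫⁻ t in Icc b (b + d), F t) ^ p ≤ ENNReal.ofReal d ^ (p - 1) * ∫⁻ t in Icc b (b + d), F t ^ p := by
  have hp0 : 0 < p := by linarith
  have hpq := Real.HolderConjugate.conjExponent hp
  have := ENNReal.lintegral_mul_le_Lp_mul_Lq (volume.restrict (Icc b (b + d))) hpq hF.aemeasurable
    (measurable_const (a := (1 : ENNReal))).aemeasurable
  simp only [Pi.mul_apply, mul_one, ENNReal.one_rpow, lintegral_const, one_mul, Measure.restrict_apply MeasurableSet.univ,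
    univ_inter, Real.volume_Icc, add_sub_cancel_left] at this
  calc _ ≤ _ := ENNReal.rpow_le_rpow this hp0.le
    _ = _ := by
      rw [ENNReal.mul_rpow_of_nonneg _ _ hp0.le, ← ENNReal.rpow_mul, ← ENNReal.rpow_mul, one_div_mul_cancel hp0.ne',
        ENNReal.rpow_one, mul_comm]
      congr 2
      rw [Real.conjExponent]
      field_simp

theorem knA_cost {g : ℝ → ℝ} (hg : Measurable g) {lo hi : ℝ} (hlo : 0 < lo) (h1 : ∀ t, lo ≤ g t)
    (h2 : ∀ t, g t ≤ hi) (b d : ℝ) (hd : 0 < d) (p : ℝ) (hp : 1 < p) :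
    ∫⁻ t in Icc b (b + d), ‖knA g b d t - t‖ₑ ^ p * ENNReal.ofReal (g t) ≤
      (ENNReal.ofReal d ^ p * ENNReal.ofReal lo ^ (1 - p)) *
        ∫⁻ t in Icc b (b + d), ‖g t - knM g b d‖ₑ ^ p := by
  have hp0 : 0 < p := by linarith
  have hM := knM_bd hg hlo h1 h2 b d hd
  have hM0 : 0 < knM g b d := hlo.trans_le hM.1
  set M' := ENNReal.ofReal (knM g b d) with hM'
  have hM'0 : M' ≠ 0 := by simp [hM', hM0]
  have hM't : M' ≠ ⊤ := by simp [hM']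
  have hd0 : ENNReal.ofReal d ≠ 0 := by simp [hd]
  set J := ∫⁻ t in Icc b (b + d), ‖g t - knM g b d‖ₑ with hJ
  have hpt : ∀ t ∈ Icc b (b + d), ‖knA g b d t - t‖ₑ ≤ J / M' := by
    intro t ht
    have e1 : knA g b d t - t = (∫ s in b..t, (g s - knM g b d)) / knM g b d := by
      rw [intervalIntegral.integral_sub (kn_ii hg hlo h1 h2 b t) intervalIntegrable_const]
      simp only [knA, intervalIntegral.integral_const, smul_eq_mul]
      field_simp
      ring
    have e2 : ‖knM g b d‖ₑ = M' := by
      rw [← ofReal_norm, Real.norm_of_nonneg hM0.le]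
    rw [e1, div_eq_mul_inv, enorm_mul, enorm_inv hM0.ne', e2, ← div_eq_mul_inv]
    gcongr
    rw [intervalIntegral.integral_of_le ht.1]
    refine (enorm_integral_le_lintegral_enorm _).trans ?_
    exact lintegral_mono_set (fun s hs => ⟨hs.1.le, hs.2.trans ht.2⟩)
  have hmass : ∫⁻ t in Icc b (b + d), ENNReal.ofReal (g t) = M' * ENNReal.ofReal d := by
    have := knA_lint hg hlo h1 h2 b d hd (fun _ => 1) measurable_const
    simp only [one_mul] at this
    rw [this, setLIntegral_const, Real.volume_Icc, add_sub_cancel_left]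
  calc _ ≤ ∫⁻ t in Icc b (b + d), (J / M') ^ p * ENNReal.ofReal (g t) := by
        apply setLIntegral_mono' measurableSet_Icc
        intro t ht
        gcongr
        exact hpt t ht
    _ = J ^ p * (M' ^ (1 - p) * ENNReal.ofReal d) := by
        rw [lintegral_const_mul _ hg.ennreal_ofReal, hmass, ENNReal.div_rpow_of_nonneg _ _ hp0.le,
          sub_eq_add_neg, ENNReal.rpow_add _ _ hM'0 hM't, ENNReal.rpow_one, div_eq_mul_inv, ENNReal.rpow_neg]
        ring
    _ ≤ (ENNReal.ofReal d ^ (p - 1) * ∫⁻ t in Icc b (b + d), ‖g t - knM g b d‖ₑ ^ p) *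
          (ENNReal.ofReal lo ^ (1 - p) * ENNReal.ofReal d) := by
        refine mul_le_mul' ?_ (mul_le_mul' ?_ le_rfl)
        · exact jensen_Icc p hp b d _ (by fun_prop)
        · rw [show (1 - p) = -(p - 1) by ring, ENNReal.rpow_neg, ENNReal.rpow_neg]
          apply ENNReal.inv_le_inv.2
          apply ENNReal.rpow_le_rpow _ (by linarith)
          exact ENNReal.ofReal_le_ofReal hM.1
    _ = _ := by
        have : ENNReal.ofReal d ^ p = ENNReal.ofReal d ^ (p - 1) * ENNReal.ofReal d := by
          nth_rewrite 3 [← ENNReal.rpow_one (ENNReal.ofReal d)]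
          rw [← ENNReal.rpow_add _ _ hd0 (by simp)]
          ring_nf
        rw [this]
        ring

theorem knM_jensen {g : ℝ → ℝ} (hg : Measurable g) {lo hi : ℝ} (hlo : 0 < lo) (h1 : ∀ t, lo ≤ g t)
    (h2 : ∀ t, g t ≤ hi) (b d : ℝ) (hd : 0 < d) (p : ℝ) (hp : 1 < p) (κ : ℝ) :
    ∫⁻ _ in Icc b (b + d), ‖knM g b d - κ‖ₑ ^ p ≤ ∫⁻ t in Icc b (b + d), ‖g t - κ‖ₑ ^ p := by
  have hp0 : 0 < p := by linarith
  have hd0 : ENNReal.ofReal d ≠ 0 := by simp [hd]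
  have hdt : ENNReal.ofReal d ≠ ⊤ := by simp
  have e1 : knM g b d - κ = (∫ s in b..(b + d), (g s - κ)) / d := by
    rw [intervalIntegral.integral_sub (kn_ii hg hlo h1 h2 b _) intervalIntegrable_const]
    simp only [knM, intervalIntegral.integral_const, smul_eq_mul]
    field_simp
    ring
  have e2 : ‖d‖ₑ = ENNReal.ofReal d := by
    rw [← ofReal_norm, Real.norm_of_nonneg hd.le]
  have e3 : ‖knM g b d - κ‖ₑ ≤ (∫⁻ t in Icc b (b + d), ‖g t - κ‖ₑ) / ENNReal.ofReal d := by
    rw [e1, div_eq_mul_inv, enorm_mul, enorm_inv hd.ne', e2, ← div_eq_mul_inv]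
    gcongr
    rw [intervalIntegral.integral_of_le (by linarith)]
    refine (enorm_integral_le_lintegral_enorm _).trans ?_
    exact lintegral_mono_set Ioc_subset_Icc_self
  rw [setLIntegral_const, Real.volume_Icc, add_sub_cancel_left]
  calc _ ≤ ((∫⁻ t in Icc b (b + d), ‖g t - κ‖ₑ) / ENNReal.ofReal d) ^ p * ENNReal.ofReal d := by gcongr
    _ = (∫⁻ t in Icc b (b + d), ‖g t - κ‖ₑ) ^ p / ENNReal.ofReal d ^ p * ENNReal.ofReal d := by
        rw [ENNReal.div_rpow_of_nonneg _ _ hp0.le]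
    _ ≤ (ENNReal.ofReal d ^ (p - 1) * ∫⁻ t in Icc b (b + d), ‖g t - κ‖ₑ ^ p) / ENNReal.ofReal d ^ p * ENNReal.ofReal d := by
        gcongr
        exact jensen_Icc p hp b d _ (by fun_prop)
    _ = (ENNReal.ofReal d ^ (p - 1) * ENNReal.ofReal d) / ENNReal.ofReal d ^ p * ∫⁻ t in Icc b (b + d), ‖g t - κ‖ₑ ^ p := by
        rw [div_eq_mul_inv, div_eq_mul_inv]
        ring
    _ = _ := by
        have : ENNReal.ofReal d ^ p = ENNReal.ofReal d ^ (p - 1) * ENNReal.ofReal d := by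
          nth_rewrite 3 [← ENNReal.rpow_one (ENNReal.ofReal d)]
          rw [← ENNReal.rpow_add _ _ hd0 (by simp)]
          ring_nf
        rw [← this, ENNReal.div_self, one_mul]
        · simp [hd]
        · exact ENNReal.rpow_ne_top_of_nonneg hp0.le hdt

/-- average of `f` in coordinate `i` -/
def opA {n : ℕ} (b : Fin n → ℝ) (d : ℝ) (i : Fin n) (f : (Fin n → ℝ) → ℝ) (x : Fin n → ℝ) : ℝ :=
  knM (fun s => f (Function.update x i s)) (b i) d

/-- monotone rearrangement in coordinate `i` -/
def opT {n : ℕ} (b : Fin n → ℝ) (d : ℝ) (i : Fin n) (f : (Fin n → ℝ) → ℝ) (x : Fin n → ℝ) : Fin n → ℝ :=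
  Function.update x i (knA (fun s => f (Function.update x i s)) (b i) d (x i))

/-- Lebesgue measure on the cube -/
def cubeM {n : ℕ} (b : Fin n → ℝ) (d : ℝ) : Measure (Fin n → ℝ) :=
  Measure.pi fun i => volume.restrict (Icc (b i) (b i + d))

theorem cubeM_eq {n : ℕ} (b : Fin n → ℝ) (d : ℝ) :
    cubeM b d = volume.restrict (Set.pi univ fun i => Icc (b i) (b i + d)) := by
  rw [cubeM, volume_pi, Measure.restrict_pi_pi]

theorem opA_upd {n : ℕ} (b : Fin n → ℝ) (d : ℝ) (i : Fin n) (f : (Fin n → ℝ) → ℝ) (x : Fin n → ℝ) (s : ℝ) :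
    opA b d i f (Function.update x i s) = opA b d i f x := by
  simp only [opA, Function.update_idem]

theorem opT_upd {n : ℕ} (b : Fin n → ℝ) (d : ℝ) (i : Fin n) (f : (Fin n → ℝ) → ℝ) (x : Fin n → ℝ) (s : ℝ) :
    opT b d i f (Function.update x i s) =
      Function.update x i (knA (fun s => f (Function.update x i s)) (b i) d s) := by
  simp only [opT, Function.update_idem, Function.update_self]

theorem opA_upd_ne {n : ℕ} (b : Fin n → ℝ) (d : ℝ) (i j : Fin n) (hij : i ≠ j) (f : (Fin n → ℝ) → ℝ)
    (hf : ∀ x s, f (Function.update x j s) = f x) (x : Fin n → ℝ) (s : ℝ) :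
    opA b d i f (Function.update x j s) = opA b d i f x := by
  simp only [opA]
  congr 1
  funext t
  rw [Function.update_comm hij.symm, hf]

theorem line_meas {n : ℕ} (i : Fin n) {f : (Fin n → ℝ) → ℝ} (hf : Measurable f) (x : Fin n → ℝ) :
    Measurable fun s => f (Function.update x i s) := hf.comp (measurable_update x)

theorem opA_meas {n : ℕ} (b : Fin n → ℝ) (d : ℝ) (hd : 0 < d) (i : Fin n) {f : (Fin n → ℝ) → ℝ} (hf : Measurable f) :
    Measurable (opA b d i f) := by
  have h1 : Measurable (fun z : (Fin n → ℝ) × ℝ => f (Function.update z.1 i z.2)) :=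
    hf.comp measurable_update'
  have h2 : StronglyMeasurable (fun x : Fin n → ℝ => ∫ s in Ioc (b i) (b i + d), f (Function.update x i s)) :=
    StronglyMeasurable.integral_prod_right (f := fun x s => f (Function.update x i s)) h1.stronglyMeasurable
  have h3 : opA b d i f = fun x => (∫ s in Ioc (b i) (b i + d), f (Function.update x i s)) / d := by
    funext x
    simp only [opA, knM]
    rw [intervalIntegral.integral_of_le (by linarith)]
  rw [h3]
  exact h2.measurable.div_const d

theorem opT_meas {n : ℕ} (b : Fin n → ℝ) (d : ℝ) (hd : 0 < d) (i : Fin n) {f : (Fin n → ℝ) → ℝ} (hf : Measurable f) :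
    Measurable (opT b d i f) := by
  have h0 : Measurable (fun z : (Fin n → ℝ) × ℝ => Function.update z.1 i (b i + (z.1 i - b i) * z.2)) := by
    have : Measurable (fun z : (Fin n → ℝ) × ℝ => (z.1, b i + (z.1 i - b i) * z.2)) := by fun_prop
    exact measurable_update'.comp this
  have h1 : Measurable (fun z : (Fin n → ℝ) × ℝ => f (Function.update z.1 i (b i + (z.1 i - b i) * z.2))) :=
    hf.comp h0
  have h2 : StronglyMeasurable (fun x : Fin n → ℝ => ∫ s in Ioc (0:ℝ) 1, f (Function.update x i (b i + (x i - b i) * s))) :=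
    StronglyMeasurable.integral_prod_right (f := fun x s => f (Function.update x i (b i + (x i - b i) * s))) h1.stronglyMeasurable
  have h3 : opT b d i f = fun x => Function.update x i (b i + ((x i - b i) *
      (∫ s in Ioc (0:ℝ) 1, f (Function.update x i (b i + (x i - b i) * s)))) / opA b d i f x) := by
    funext x
    simp only [opT, knA, opA]
    congr 3
    rw [← intervalIntegral.integral_of_le zero_le_one,
      intervalIntegral.mul_integral_comp_add_mul (f := fun s => f (Function.update x i s))]
    simp
  rw [h3]
  have h4 : Measurable (fun x : Fin n → ℝ => (x, b i + ((x i - b i) *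
      (∫ s in Ioc (0:ℝ) 1, f (Function.update x i (b i + (x i - b i) * s)))) / opA b d i f x)) := by
    refine measurable_id.prodMk ?_
    refine measurable_const.add (Measurable.div (Measurable.mul ?_ h2.measurable) (opA_meas b d hd i hf))
    fun_prop
  exact measurable_update'.comp h4

theorem opA_bd {n : ℕ} (b : Fin n → ℝ) (d : ℝ) (hd : 0 < d) (i : Fin n) {f : (Fin n → ℝ) → ℝ} (hf : Measurable f)
    {lo hi : ℝ} (hlo : 0 < lo) (h1 : ∀ x, lo ≤ f x) (h2 : ∀ x, f x ≤ hi) (x : Fin n → ℝ) :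
    lo ≤ opA b d i f x ∧ opA b d i f x ≤ hi :=
  knM_bd (line_meas i hf x) hlo (fun _ => h1 _) (fun _ => h2 _) _ _ hd

theorem opT_mem {n : ℕ} (b : Fin n → ℝ) (d : ℝ) (hd : 0 < d) (i : Fin n) {f : (Fin n → ℝ) → ℝ} (hf : Measurable f)
    {lo hi : ℝ} (hlo : 0 < lo) (h1 : ∀ x, lo ≤ f x) (h2 : ∀ x, f x ≤ hi) (x : Fin n → ℝ)
    (hx : x ∈ Set.pi univ fun i => Icc (b i) (b i + d)) :
    opT b d i f x ∈ Set.pi univ fun i => Icc (b i) (b i + d) := by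
  intro j _
  by_cases hj : j = i
  · subst hj
    have hsm := knA_strictMono (line_meas j hf x) hlo (fun _ => h1 _) (fun _ => h2 _) (b j) d hd
    have hxj := hx j (mem_univ j)
    simp only [opT, Function.update_self]
    constructor
    · have := hsm.monotone hxj.1
      rwa [knA_left] at this
    · have := hsm.monotone hxj.2
      rwa [knA_right (line_meas j hf x) hlo (fun _ => h1 _) (fun _ => h2 _) (b j) d hd] at this
  · simp only [opT, Function.update_of_ne hj]
    exact hx j (mem_univ j)

theorem opT_lint {n : ℕ} (b : Fin n → ℝ) (d : ℝ) (hd : 0 < d) (i : Fin n) {f : (Fin n → ℝ) → ℝ} (hf : Measurable f)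
    {lo hi : ℝ} (hlo : 0 < lo) (h1 : ∀ x, lo ≤ f x) (h2 : ∀ x, f x ≤ hi) (F : (Fin n → ℝ) → ENNReal) (hF : Measurable F) :
    ∫⁻ x, F (opT b d i f x) * ENNReal.ofReal (f x) ∂(cubeM b d) =
      ∫⁻ x, F x * ENNReal.ofReal (opA b d i f x) ∂(cubeM b d) := by
  refine lintegral_eq_of_lmarginal_eq {i} ((hF.comp (opT_meas b d hd i hf)).mul hf.ennreal_ofReal)
    (hF.mul (opA_meas b d hd i hf).ennreal_ofReal) ?_
  funext x
  rw [lmarginal_singleton, lmarginal_singleton]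
  simp only [opT_upd, opA_upd]
  exact knA_lint (line_meas i hf x) hlo (fun _ => h1 _) (fun _ => h2 _) (b i) d hd
    (fun s => F (Function.update x i s)) (hF.comp (measurable_update x))

theorem opT_cost {n : ℕ} (b : Fin n → ℝ) (d : ℝ) (hd : 0 < d) (i : Fin n) {f : (Fin n → ℝ) → ℝ} (hf : Measurable f)
    {lo hi : ℝ} (hlo : 0 < lo) (h1 : ∀ x, lo ≤ f x) (h2 : ∀ x, f x ≤ hi) (p : ℝ) (hp : 1 < p) :
    ∫⁻ x, ‖opT b d i f x - x‖ₑ ^ p * ENNReal.ofReal (f x) ∂(cubeM b d) ≤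
      (ENNReal.ofReal d ^ p * ENNReal.ofReal lo ^ (1 - p)) *
        ∫⁻ x, ‖f x - opA b d i f x‖ₑ ^ p ∂(cubeM b d) := by
  have hm : Measurable fun x => ‖f x - opA b d i f x‖ₑ ^ p :=
    ((hf.sub (opA_meas b d hd i hf)).enorm).pow_const p
  rw [← lintegral_const_mul _ hm]
  refine lintegral_le_of_lmarginal_le {i}
    (((((opT_meas b d hd i hf).sub measurable_id).enorm).pow_const p).mul hf.ennreal_ofReal)
    (measurable_const.mul hm) ?_
  intro x
  rw [lmarginal_singleton, lmarginal_singleton]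
  simp only [opT_upd, opA_upd]
  have hlm : Measurable fun s => ‖f (Function.update x i s) - opA b d i f x‖ₑ ^ p :=
    ((line_meas i hf x).sub measurable_const).enorm.pow_const p
  rw [lintegral_const_mul _ hlm]
  refine le_trans ?_ (knA_cost (line_meas i hf x) hlo (fun _ => h1 _) (fun _ => h2 _) (b i) d hd p hp)
  apply lintegral_mono
  intro s
  refine mul_le_mul' (ENNReal.rpow_le_rpow ?_ (by linarith)) le_rfl
  rw [← ofReal_norm, ← ofReal_norm]
  apply ENNReal.ofReal_le_ofReal
  rw [pi_norm_le_iff_of_nonneg (norm_nonneg _)]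
  intro j
  by_cases hj : j = i
  · subst hj
    simp
  · simp [hj]

theorem opA_jensen {n : ℕ} (b : Fin n → ℝ) (d : ℝ) (hd : 0 < d) (i : Fin n) {f : (Fin n → ℝ) → ℝ} (hf : Measurable f)
    {lo hi : ℝ} (hlo : 0 < lo) (h1 : ∀ x, lo ≤ f x) (h2 : ∀ x, f x ≤ hi) (p : ℝ) (hp : 1 < p) (κ : ℝ) :
    ∫⁻ x, ‖opA b d i f x - κ‖ₑ ^ p ∂(cubeM b d) ≤ ∫⁻ x, ‖f x - κ‖ₑ ^ p ∂(cubeM b d) := by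
  refine lintegral_le_of_lmarginal_le {i}
    ((((opA_meas b d hd i hf).sub measurable_const).enorm).pow_const p)
    (((hf.sub measurable_const).enorm).pow_const p) ?_
  intro x
  rw [lmarginal_singleton, lmarginal_singleton]
  simp only [opA_upd]
  exact knM_jensen (line_meas i hf x) hlo (fun _ => h1 _) (fun _ => h2 _) (b i) d hd p hp κ

theorem opT_cost2 {n : ℕ} (b : Fin n → ℝ) (d : ℝ) (hd : 0 < d) (i : Fin n) {f : (Fin n → ℝ) → ℝ} (hf : Measurable f)
    {lo hi : ℝ} (hlo : 0 < lo) (h1 : ∀ x, lo ≤ f x) (h2 : ∀ x, f x ≤ hi) (p : ℝ) (hp : 1 < p) (κ : ℝ) :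
    ∫⁻ x, ‖opT b d i f x - x‖ₑ ^ p * ENNReal.ofReal (f x) ∂(cubeM b d) ≤
      2 ^ p * 2 * ((ENNReal.ofReal d ^ p * ENNReal.ofReal lo ^ (1 - p)) *
        ∫⁻ x, ‖f x - κ‖ₑ ^ p ∂(cubeM b d)) := by
  refine (opT_cost b d hd i hf hlo h1 h2 p hp).trans ?_
  have hm1 : Measurable fun x => ‖f x - κ‖ₑ ^ p := ((hf.sub measurable_const).enorm).pow_const p
  have hm2 : Measurable fun x => ‖opA b d i f x - κ‖ₑ ^ p :=
    ((((opA_meas b d hd i hf).sub measurable_const).enorm).pow_const p)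
  have : ∫⁻ x, ‖f x - opA b d i f x‖ₑ ^ p ∂(cubeM b d) ≤ 2 ^ p * (2 * ∫⁻ x, ‖f x - κ‖ₑ ^ p ∂(cubeM b d)) := by
    calc _ ≤ ∫⁻ x, 2 ^ p * (‖f x - κ‖ₑ ^ p + ‖opA b d i f x - κ‖ₑ ^ p) ∂(cubeM b d) := by
          apply lintegral_mono
          intro x
          refine le_trans ?_ (add_rpow_two p hp _ _)
          apply ENNReal.rpow_le_rpow _ (by linarith)
          rw [show f x - opA b d i f x = (f x - κ) - (opA b d i f x - κ) by ring]
          exact enorm_sub_le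
      _ = 2 ^ p * (∫⁻ x, ‖f x - κ‖ₑ ^ p ∂(cubeM b d) + ∫⁻ x, ‖opA b d i f x - κ‖ₑ ^ p ∂(cubeM b d)) := by
          rw [lintegral_const_mul _ (show Measurable (fun x => ‖f x - κ‖ₑ ^ p + ‖opA b d i f x - κ‖ₑ ^ p) from hm1.add hm2),
            lintegral_add_left hm1]
      _ ≤ _ := by
          rw [two_mul]
          exact mul_le_mul' le_rfl (add_le_add le_rfl (opA_jensen b d hd i hf hlo h1 h2 p hp κ))
  calc _ ≤ (ENNReal.ofReal d ^ p * ENNReal.ofReal lo ^ (1 - p)) * (2 ^ p * (2 * ∫⁻ x, ‖f x - κ‖ₑ ^ p ∂(cubeM b d))) := by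
        gcongr
    _ = _ := by ring

/-- constants -/
def knC (p : ℝ) : ℕ → ENNReal
  | 0 => 0
  | k + 1 => 2 ^ p * (knC p k + 2 ^ p * 2)

theorem knC_ne_top (p : ℝ) (hp : 1 < p) (k : ℕ) : knC p k ≠ ⊤ := by
  have h2p : (2 : ENNReal) ^ p ≠ ⊤ := ENNReal.rpow_ne_top_of_nonneg (by linarith) (by simp)
  induction k with
  | zero => simp [knC]
  | succ k ih =>
    simp only [knC]
    exact ENNReal.mul_ne_top h2p (ENNReal.add_ne_top.2 ⟨ih, ENNReal.mul_ne_top h2p (by simp)⟩)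

theorem knothe_aux {n : ℕ} (b : Fin n → ℝ) (d : ℝ) (hd : 0 < d) {f : (Fin n → ℝ) → ℝ} (hf : Measurable f)
    {lo hi : ℝ} (hlo : 0 < lo) (h1 : ∀ x, lo ≤ f x) (h2 : ∀ x, f x ≤ hi) (p : ℝ) (hp : 1 < p) (κ : ℝ)
    (k : ℕ) (hk : k ≤ n) :
    ∃ (T : (Fin n → ℝ) → (Fin n → ℝ)) (fk : (Fin n → ℝ) → ℝ), Measurable T ∧ Measurable fk ∧
      (∀ x, lo ≤ fk x) ∧ (∀ x, fk x ≤ hi) ∧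
      (∀ j : Fin n, (j : ℕ) < k → ∀ x s, fk (Function.update x j s) = fk x) ∧
      (∀ x ∈ Set.pi univ fun i => Icc (b i) (b i + d), T x ∈ Set.pi univ fun i => Icc (b i) (b i + d)) ∧
      (∀ F : (Fin n → ℝ) → ENNReal, Measurable F → ∫⁻ x, F (T x) * ENNReal.ofReal (f x) ∂(cubeM b d) =
        ∫⁻ x, F x * ENNReal.ofReal (fk x) ∂(cubeM b d)) ∧
      ∫⁻ x, ‖T x - x‖ₑ ^ p * ENNReal.ofReal (f x) ∂(cubeM b d) ≤
        knC p k * ((ENNReal.ofReal d ^ p * ENNReal.ofReal lo ^ (1 - p)) * ∫⁻ x, ‖f x - κ‖ₑ ^ p ∂(cubeM b d)) ∧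
      ∫⁻ x, ‖fk x - κ‖ₑ ^ p ∂(cubeM b d) ≤ ∫⁻ x, ‖f x - κ‖ₑ ^ p ∂(cubeM b d) := by
  have hp0 : 0 < p := by linarith
  induction k with
  | zero =>
    refine ⟨id, f, measurable_id, hf, h1, h2, by simp, by simp, by simp, ?_, le_rfl⟩
    simp [knC, ENNReal.zero_rpow_of_pos hp0]
  | succ k ih =>
    obtain ⟨T, fk, hT, hfk, hfk1, hfk2, hind, hTQ, hpush, hcost, hjen⟩ := ih (by omega)
    set i : Fin n := ⟨k, by omega⟩ with hi_def
    refine ⟨fun x => opT b d i fk (T x), opA b d i fk, (opT_meas b d hd i hfk).comp hT, opA_meas b d hd i hfk,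
      fun x => (opA_bd b d hd i hfk hlo hfk1 hfk2 x).1, fun x => (opA_bd b d hd i hfk hlo hfk1 hfk2 x).2,
      ?_, fun x hx => opT_mem b d hd i hfk hlo hfk1 hfk2 _ (hTQ x hx), ?_, ?_,
      (opA_jensen b d hd i hfk hlo hfk1 hfk2 p hp κ).trans hjen⟩
    · intro j hj x s
      by_cases hji : j = i
      · rw [hji]
        exact opA_upd b d i fk x s
      · refine opA_upd_ne b d i j (Ne.symm hji) fk (hind j ?_) x s
        have : (j : ℕ) ≠ k := fun h => hji (Fin.ext h)
        omega
    · intro F hF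
      rw [hpush (fun y => F (opT b d i fk y)) (hF.comp (opT_meas b d hd i hfk))]
      exact opT_lint b d hd i hfk hlo hfk1 hfk2 F hF
    · have hmG : Measurable fun y => ‖opT b d i fk y - y‖ₑ ^ p :=
        (((opT_meas b d hd i hfk).sub measurable_id).enorm).pow_const p
      have hmT : Measurable fun x => ‖T x - x‖ₑ ^ p * ENNReal.ofReal (f x) :=
        ((hT.sub measurable_id).enorm.pow_const p).mul hf.ennreal_ofReal
      have hmS : Measurable fun x => ‖opT b d i fk (T x) - T x‖ₑ ^ p * ENNReal.ofReal (f x) :=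
        (hmG.comp hT).mul hf.ennreal_ofReal
      calc _ ≤ ∫⁻ x, 2 ^ p * (‖T x - x‖ₑ ^ p * ENNReal.ofReal (f x) + ‖opT b d i fk (T x) - T x‖ₑ ^ p * ENNReal.ofReal (f x)) ∂(cubeM b d) := by
            apply lintegral_mono
            intro x
            simp only
            rw [← add_mul, ← mul_assoc]
            gcongr
            refine le_trans ?_ (add_rpow_two p hp _ _)
            apply ENNReal.rpow_le_rpow _ hp0.le
            rw [show opT b d i fk (T x) - x = (T x - x) + (opT b d i fk (T x) - T x) by abel]
            exact enorm_add_le _ _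
        _ = 2 ^ p * (∫⁻ x, ‖T x - x‖ₑ ^ p * ENNReal.ofReal (f x) ∂(cubeM b d) +
              ∫⁻ y, ‖opT b d i fk y - y‖ₑ ^ p * ENNReal.ofReal (fk y) ∂(cubeM b d)) := by
            rw [← hpush _ hmG, lintegral_const_mul _ (show Measurable (fun x => ‖T x - x‖ₑ ^ p * ENNReal.ofReal (f x) +
              ‖opT b d i fk (T x) - T x‖ₑ ^ p * ENNReal.ofReal (f x)) from hmT.add hmS), lintegral_add_left hmT]
        _ ≤ 2 ^ p * (knC p k * ((ENNReal.ofReal d ^ p * ENNReal.ofReal lo ^ (1 - p)) * ∫⁻ x, ‖f x - κ‖ₑ ^ p ∂(cubeM b d)) +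
              2 ^ p * 2 * ((ENNReal.ofReal d ^ p * ENNReal.ofReal lo ^ (1 - p)) * ∫⁻ x, ‖f x - κ‖ₑ ^ p ∂(cubeM b d))) := by
            gcongr
            refine (opT_cost2 b d hd i hfk hlo hfk1 hfk2 p hp κ).trans ?_
            gcongr
        _ = _ := by
            simp only [knC]
            ring

theorem const_of_upd {n : ℕ} (f : (Fin n → ℝ) → ℝ) (h : ∀ j x s, f (Function.update x j s) = f x)
    (x y : Fin n → ℝ) : f x = f y := by
  have key : ∀ S : Finset (Fin n), f (fun i => if i ∈ S then y i else x i) = f x := by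
    intro S
    induction S using Finset.induction_on with
    | empty => simp
    | insert a S ha ih =>
      rw [← ih, ← h a (fun i => if i ∈ S then y i else x i) (y a)]
      congr 1
      funext i
      by_cases hia : i = a
      · subst hia; simp
      · simp [hia]
  have := key Finset.univ
  simpa using this.symm

theorem knothe {n : ℕ} (b : Fin n → ℝ) (d : ℝ) (hd : 0 < d) {f : (Fin n → ℝ) → ℝ} (hf : Measurable f)
    {lo hi : ℝ} (hlo : 0 < lo) (h1 : ∀ x, lo ≤ f x) (h2 : ∀ x, f x ≤ hi) (p : ℝ) (hp : 1 < p) (κ : ℝ) (hκ : 0 < κ)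
    (hmass : ∫⁻ x, ENNReal.ofReal (f x) ∂(cubeM b d) = ENNReal.ofReal κ * cubeM b d univ) :
    ∃ T : (Fin n → ℝ) → (Fin n → ℝ), Measurable T ∧
      (∀ x ∈ Set.pi univ fun i => Icc (b i) (b i + d), T x ∈ Set.pi univ fun i => Icc (b i) (b i + d)) ∧
      (∀ F : (Fin n → ℝ) → ENNReal, Measurable F → ∫⁻ x, F (T x) * ENNReal.ofReal (f x) ∂(cubeM b d) =
        ENNReal.ofReal κ * ∫⁻ x, F x ∂(cubeM b d)) ∧
      ∫⁻ x, ‖T x - x‖ₑ ^ p * ENNReal.ofReal (f x) ∂(cubeM b d) ≤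
        knC p n * ((ENNReal.ofReal d ^ p * ENNReal.ofReal lo ^ (1 - p)) * ∫⁻ x, ‖f x - κ‖ₑ ^ p ∂(cubeM b d)) ∧
      (n = 1 → (∃ K, LipschitzWith K T) ∧ Function.Injective T) := by
  have huniv : cubeM b d univ = ENNReal.ofReal d ^ n := by
    rw [cubeM_eq, Measure.restrict_apply MeasurableSet.univ, univ_inter, volume_pi, Measure.pi_pi]
    simp
  have hu0 : cubeM b d univ ≠ 0 := by rw [huniv]; simp [hd]
  have hut : cubeM b d univ ≠ ⊤ := by rw [huniv]; simp
  have hconst : ∀ fk : (Fin n → ℝ) → ℝ, (∀ x, lo ≤ fk x) → (∀ j x s, fk (Function.update x j s) = fk x) →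
      ∫⁻ x, ENNReal.ofReal (f x) ∂(cubeM b d) = ∫⁻ x, ENNReal.ofReal (fk x) ∂(cubeM b d) → ∀ x, fk x = κ := by
    intro fk hfk1 hupd hm x
    have hc : ∀ y, fk y = fk x := fun y => const_of_upd fk hupd y x
    simp only [hc] at hm
    rw [hmass, lintegral_const, ENNReal.mul_left_inj hu0 hut] at hm
    exact ((ENNReal.ofReal_eq_ofReal_iff hκ.le (hlo.le.trans (hfk1 x))).1 hm).symm
  by_cases hn1 : n = 1
  · subst hn1
    have hfree : ∀ (x : Fin 1 → ℝ) (s : ℝ), Function.update x (0 : Fin 1) s = fun _ => s := by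
      intro x s
      funext j
      rw [Subsingleton.elim j 0]
      simp
    have hk : ∀ x, opA b d 0 f x = κ := by
      apply hconst _ (fun x => (opA_bd b d hd 0 hf hlo h1 h2 x).1)
      · intro j x s
        rw [Subsingleton.elim j 0]
        exact opA_upd b d 0 f x s
      · have := opT_lint b d hd 0 hf hlo h1 h2 (fun _ => 1) measurable_const
        simpa using this
    refine ⟨opT b d 0 f, opT_meas b d hd 0 hf, opT_mem b d hd 0 hf hlo h1 h2, ?_, ?_, fun _ => ?_⟩
    · intro F hF
      rw [opT_lint b d hd 0 hf hlo h1 h2 F hF]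
      simp only [hk]
      rw [lintegral_mul_const _ hF, mul_comm]
    · refine (opT_cost2 b d hd 0 hf hlo h1 h2 p hp κ).trans ?_
      gcongr
      simp only [knC, zero_add]
      refine le_mul_of_one_le_left zero_le ?_
      apply ENNReal.one_le_rpow (by norm_num) (by linarith)
    · have hgm : Measurable (fun s : ℝ => f (fun _ => s)) := hf.comp (by fun_prop)
      have hTe : opT b d 0 f = fun x => fun _ => knA (fun s => f (fun _ => s)) (b 0) d (x 0) := by
        funext x
        simp only [opT, hfree]
      have hl := knA_lip hgm hlo (fun _ => h1 _) (fun _ => h2 _) (b 0) d hd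
      have hs := knA_strictMono hgm hlo (fun _ => h1 _) (fun _ => h2 _) (b 0) d hd
      rw [hTe]
      constructor
      · refine ⟨(hi / lo).toNNReal, ?_⟩
        apply LipschitzWith.of_dist_le_mul
        intro x y
        rw [dist_pi_le_iff (by positivity)]
        intro j
        refine (hl.dist_le_mul _ _).trans ?_
        gcongr
        exact dist_le_pi_dist x y 0
      · intro x y hxy
        have := hs.injective (congrFun hxy 0)
        funext j
        rw [Subsingleton.elim j 0]
        exact this
  · obtain ⟨T, fk, hT, hfk, hfk1, hfk2, hind, hTQ, hpush, hcost, hjen⟩ :=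
      knothe_aux b d hd hf hlo h1 h2 p hp κ n le_rfl
    refine ⟨T, hT, hTQ, ?_, hcost, fun h => absurd h hn1⟩
    have hk := hconst fk hfk1 (fun j => hind j j.2) (by simpa using hpush (fun _ => 1) measurable_const)
    intro F hF
    rw [hpush F hF]
    simp only [hk]
    rw [lintegral_mul_const _ hF, mul_comm]

theorem exists_inj_r {E : Type*} [NormedAddCommGroup E] [NormedSpace ℝ E] [FiniteDimensional ℝ E]
    (A : E →L[ℝ] E) : ∃ r : NNReal, r ≠ 0 ∧ (A.det ≠ 0 → ∀ (f : E → E) (s : Set E),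
      ApproximatesLinearOn f A s r → InjOn f s) := by
  by_cases h : A.det ≠ 0
  · let B : E ≃L[ℝ] E := A.toContinuousLinearEquivOfDetNeZero h
    have hB : (B : E →L[ℝ] E) = A := A.coe_toContinuousLinearEquivOfDetNeZero h
    rcases subsingleton_or_nontrivial E with hs | hs
    · exact ⟨1, one_ne_zero, fun _ f s _ x _ y _ _ => Subsingleton.elim _ _⟩
    · have hpos : 0 < ‖(B.symm : E →L[ℝ] E)‖₊ := by
        exact B.nnnorm_symm_pos
      refine ⟨‖(B.symm : E →L[ℝ] E)‖₊⁻¹ / 2, by positivity, fun _ f s hf => ?_⟩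
      rw [← hB] at hf
      exact hf.injOn (Or.inr (NNReal.half_lt_self (by positivity)))
  · exact ⟨1, one_ne_zero, fun h' => absurd h' h⟩

theorem lip_null {n : ℕ} {u : EuclideanSpace ℝ (Fin n) → EuclideanSpace ℝ (Fin n)} {K : NNReal}
    (hu : LipschitzWith K u) {N : Set (EuclideanSpace ℝ (Fin n))} (hN : volume N = 0) :
    volume (u '' N) = 0 := by
  have h1 : (Measure.hausdorffMeasure (Module.finrank ℝ (EuclideanSpace ℝ (Fin n)) : ℝ) :
      Measure (EuclideanSpace ℝ (Fin n))) ≪ volume :=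
    Measure.absolutelyContinuous_isAddHaarMeasure _ _
  have h2 : (volume : Measure (EuclideanSpace ℝ (Fin n))) ≪
      Measure.hausdorffMeasure (Module.finrank ℝ (EuclideanSpace ℝ (Fin n)) : ℝ) :=
    Measure.absolutelyContinuous_isAddHaarMeasure _ _
  apply h2
  have h3 := hu.hausdorffMeasure_image_le
    (d := (Module.finrank ℝ (EuclideanSpace ℝ (Fin n)) : ℝ)) (by positivity) N
  rw [h1 hN, mul_zero] at h3
  exact le_antisymm h3 zero_le

theorem area_psi {n : ℕ} {u : EuclideanSpace ℝ (Fin n) → EuclideanSpace ℝ (Fin n)}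
    (S : Set (EuclideanSpace ℝ (Fin n))) (hS : MeasurableSet S)
    (hd : ∀ x ∈ S, DifferentiableAt ℝ u x) (hinj : InjOn u S) (hpos : ∀ x ∈ S, 0 < detD u x)
    (hdm : Measurable (detD u)) :
    ∃ ψ : EuclideanSpace ℝ (Fin n) → ENNReal, Measurable ψ ∧
      (∀ x ∈ S, ψ (u x) = ENNReal.ofReal (detD u x)⁻¹) ∧ MeasurableSet (u '' S) ∧
      ∀ h : EuclideanSpace ℝ (Fin n) → ENNReal,
        ∫⁻ x in S, h (u x) = ∫⁻ y in u '' S, h y * ψ y := by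
  have hfd : ∀ x ∈ S, HasFDerivWithinAt u (fderiv ℝ u x) S x :=
    fun x hx => (hd x hx).hasFDerivAt.hasFDerivWithinAt
  have hemb := measurableEmbedding_of_fderivWithin hS hfd hinj
  obtain ⟨ψ, hψm, hψ⟩ := hemb.exists_measurable_extend
    (g := fun x : S => ENNReal.ofReal (detD u x)⁻¹)
    ((hdm.comp measurable_subtype_coe).inv.ennreal_ofReal) (fun _ => ⟨0⟩)
  have hψ' : ∀ x ∈ S, ψ (u x) = ENNReal.ofReal (detD u x)⁻¹ := fun x hx =>
    congrFun hψ ⟨x, hx⟩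
  refine ⟨ψ, hψm, hψ', measurable_image_of_fderivWithin hS hfd hinj, fun h => ?_⟩
  rw [lintegral_image_eq_lintegral_abs_det_fderiv_mul volume hS hfd hinj]
  apply setLIntegral_congr_fun hS
  intro x hx
  simp only
  rw [hψ' x hx]
  have : (fderiv ℝ u x).det = detD u x := rfl
  rw [this, abs_of_pos (hpos x hx), mul_comm (h _), ← mul_assoc, ← ENNReal.ofReal_mul (hpos x hx).le,
    mul_inv_cancel₀ (hpos x hx).ne', ENNReal.ofReal_one, one_mul]

theorem area_lemma {n : ℕ} (U : Set (EuclideanSpace ℝ (Fin n))) (hUo : IsOpen U)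
    (u : EuclideanSpace ℝ (Fin n) → EuclideanSpace ℝ (Fin n)) (K : NNReal) (hu : LipschitzWith K u)
    (m : ℕ) (lam Lam : ℝ)
    (hm : essSup (fun y => (U ∩ u ⁻¹' {y}).encard) volume ≤ (m : ℕ∞)) (hlam : 0 < lam)
    (hae : ∀ᵐ x ∂(volume.restrict U), DifferentiableAt ℝ u x ∧
            lam ≤ detD u x ∧ detD u x ≤ Lam) :
    ∃ (E' : Set (EuclideanSpace ℝ (Fin n))) (f₀ : EuclideanSpace ℝ (Fin n) → ℝ),
      MeasurableSet E' ∧ E' ⊆ u '' U ∧ volume (u '' U \ E') = 0 ∧ Measurable f₀ ∧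
      (∀ y ∈ E', 1 / Lam ≤ f₀ y ∧ f₀ y ≤ m / lam ∧ omegaFn U u y = ENNReal.ofReal (f₀ y)) ∧
      (∀ᵐ x ∂(volume.restrict U), u x ∈ E') ∧
      ∀ h : EuclideanSpace ℝ (Fin n) → ENNReal, Measurable h →
        ∫⁻ x in U, h (u x) = ∫⁻ y in E', h y * ENNReal.ofReal (f₀ y) := by
  have hdm : Measurable (detD u) :=
    ContinuousLinearMap.continuous_det.measurable.comp (measurable_fderiv ℝ u)
  set D : Set (EuclideanSpace ℝ (Fin n)) :=
    {x | x ∈ U ∧ DifferentiableAt ℝ u x ∧ lam ≤ detD u x ∧ detD u x ≤ Lam} with hD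
  have hDm : MeasurableSet D := by
    refine hUo.measurableSet.inter ((measurableSet_of_differentiableAt ℝ u).inter
      ((measurableSet_le measurable_const hdm).inter (measurableSet_le hdm measurable_const)))
  set N := U \ D with hNdef
  have hN0 : volume N = 0 := by
    rw [ae_restrict_iff' hUo.measurableSet, ae_iff] at hae
    refine measure_mono_null (fun x hx => ?_) hae
    simp only [mem_setOf_eq]
    intro hc
    exact hx.2 ⟨hx.1, hc hx.1⟩
  have huN := lip_null hu hN0
  choose r hr0 hr using fun A : EuclideanSpace ℝ (Fin n) →L[ℝ] EuclideanSpace ℝ (Fin n) =>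
    exists_inj_r A
  obtain ⟨t, A, htd, htm, hcov, happ, hA⟩ :=
    exists_partition_approximatesLinearOn_of_hasFDerivWithinAt u D (fun x => fderiv ℝ u x)
      (fun x hx => hx.2.1.hasFDerivAt.hasFDerivWithinAt) r hr0
  have hinj : ∀ k, InjOn u (D ∩ t k) := by
    intro k
    rcases D.eq_empty_or_nonempty with h | h
    · rw [h]; simp
    · obtain ⟨y, hy, hAy⟩ := hA h k
      refine hr (A k) ?_ u _ (happ k)
      rw [hAy]
      exact (lt_of_lt_of_le hlam hy.2.2.1).ne'
  have hDpos : ∀ x ∈ D, 0 < detD u x := fun x hx => lt_of_lt_of_le hlam hx.2.2.1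
  choose ψ hψm hψ hGm hψint using fun k => area_psi (D ∩ t k) (hDm.inter (htm k))
    (fun x hx => hx.1.2.1) (hinj k) (fun x hx => hDpos x hx.1) hdm
  have hDU : D = ⋃ k, D ∩ t k := by
    rw [← inter_iUnion]; exact (inter_eq_left.2 hcov).symm
  set ω' : EuclideanSpace ℝ (Fin n) → ENNReal :=
    fun y => ∑' k, (u '' (D ∩ t k)).indicator (ψ k) y with hω'
  have hω'm : Measurable ω' := Measurable.ennreal_tsum fun k => (hψm k).indicator (hGm k)
  have hUD : (volume.restrict U : Measure (EuclideanSpace ℝ (Fin n))) = volume.restrict D := by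
    apply Measure.restrict_congr_set
    have : D ⊆ U := fun x hx => hx.1
    exact (ae_eq_set.2 ⟨hN0, by rw [diff_eq_empty.2 this]; simp⟩)
  have hform1 : ∀ h : EuclideanSpace ℝ (Fin n) → ENNReal, Measurable h →
      ∫⁻ x in U, h (u x) = ∫⁻ y, h y * ω' y := by
    intro h hh
    rw [hUD]
    conv_lhs => rw [hDU]
    rw [lintegral_iUnion (fun k => hDm.inter (htm k))
      (fun i j hij => (htd hij).mono inter_subset_right inter_subset_right)]
    simp only [hω', ← ENNReal.tsum_mul_left]
    rw [lintegral_tsum (fun k => (show Measurable (fun y => h y * (u '' (D ∩ t k)).indicator (ψ k) y) from hh.mul ((hψm k).indicator (hGm k))).aemeasurable)]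
    congr 1
    ext k
    rw [hψint k, ← lintegral_indicator (hGm k)]
    congr 1
    ext y
    by_cases hy : y ∈ u '' (D ∩ t k) <;> simp [hy]
  have hform2 : ∀ y ∉ u '' N, omegaFn U u y = ω' y := by
    intro y hy
    have hS : {x : EuclideanSpace ℝ (Fin n) |
        x ∈ U ∧ u x = y ∧ DifferentiableAt ℝ u x ∧ 0 < detD u x} = D ∩ u ⁻¹' {y} := by
      ext x
      constructor
      · rintro ⟨h1, h2, h3, h4⟩
        refine ⟨?_, h2⟩
        by_contra hc
        exact hy ⟨x, ⟨h1, hc⟩, h2⟩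
      · rintro ⟨h1, h2⟩
        exact ⟨h1.1, h2, h1.2.1, hDpos x h1⟩
    have e1 : omegaFn U u y = ∑' x, (D ∩ u ⁻¹' {y}).indicator
        (fun x => ENNReal.ofReal (detD u x)⁻¹) x := by
      rw [← hS, ← tsum_subtype]
      rfl
    have e2 : ∀ x, (D ∩ u ⁻¹' {y}).indicator (fun x => ENNReal.ofReal (detD u x)⁻¹) x
        = ∑' k, ((D ∩ t k) ∩ u ⁻¹' {y}).indicator (fun x => ENNReal.ofReal (detD u x)⁻¹) x := by
      intro x
      by_cases hx : x ∈ D ∩ u ⁻¹' {y}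
      · obtain ⟨k, hk⟩ := mem_iUnion.1 (hcov hx.1)
        rw [tsum_eq_single k]
        · rw [indicator_of_mem hx, indicator_of_mem]
          exact ⟨⟨hx.1, hk⟩, hx.2⟩
        · intro j hj
          rw [indicator_of_notMem]
          rintro ⟨⟨_, h2⟩, _⟩
          exact (htd hj).le_bot ⟨h2, hk⟩
      · rw [indicator_of_notMem hx]
        symm
        rw [ENNReal.tsum_eq_zero]
        intro k
        rw [indicator_of_notMem]
        rintro ⟨h1, h2⟩
        exact hx ⟨h1.1, h2⟩
    rw [e1]
    simp_rw [e2]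
    rw [ENNReal.tsum_comm]
    simp only [hω']
    congr 1
    ext k
    by_cases hk : y ∈ u '' (D ∩ t k)
    · rw [indicator_of_mem hk]
      obtain ⟨x, hx, rfl⟩ := hk
      rw [tsum_eq_single x, indicator_of_mem, hψ k x hx]
      · exact ⟨hx, rfl⟩
      · intro x' hne
        rw [indicator_of_notMem]
        rintro ⟨h1, h2⟩
        exact hne (hinj k h1 hx h2)
    · rw [indicator_of_notMem hk, ENNReal.tsum_eq_zero]
      intro x
      rw [indicator_of_notMem]
      rintro ⟨h1, h2⟩
      exact hk ⟨x, h1, h2⟩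
  set M := {y : EuclideanSpace ℝ (Fin n) | ¬ (U ∩ u ⁻¹' {y}).encard ≤ (m : ℕ∞)} with hM
  have hM0 : volume M = 0 := by
    have : ∀ᵐ y : EuclideanSpace ℝ (Fin n), (U ∩ u ⁻¹' {y}).encard ≤ (m : ℕ∞) := by
      filter_upwards [ae_le_essSup (μ := volume)
        (f := fun y : EuclideanSpace ℝ (Fin n) => (U ∩ u ⁻¹' {y}).encard)] with y hy
      exact hy.trans hm
    exact ae_iff.1 this
  set Z := toMeasurable volume (u '' N) ∪ toMeasurable volume M with hZ
  have hZm : MeasurableSet Z := (measurableSet_toMeasurable _ _).union (measurableSet_toMeasurable _ _)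
  have hZ0 : volume Z = 0 := by
    rw [hZ, measure_union_null_iff, measure_toMeasurable, measure_toMeasurable]
    exact ⟨huN, hM0⟩
  have hNZ : u '' N ⊆ Z := (subset_toMeasurable _ _).trans subset_union_left
  have hMZ : M ⊆ Z := (subset_toMeasurable _ _).trans subset_union_right
  have huDm : MeasurableSet (u '' D) := by
    rw [hDU, image_iUnion]
    exact MeasurableSet.iUnion hGm
  have hE'm : MeasurableSet (u '' D \ Z) := huDm.diff hZm
  have hω'off : ∀ y ∉ u '' D, ω' y = 0 := by
    intro y hy
    simp only [hω']
    rw [ENNReal.tsum_eq_zero]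
    intro k
    rw [indicator_of_notMem]
    exact fun hc => hy (image_mono inter_subset_left hc)
  have hbd : ∀ y ∈ u '' D \ Z, ENNReal.ofReal (1 / Lam) ≤ ω' y ∧ ω' y ≤ ENNReal.ofReal (m / lam) := by
    rintro y ⟨⟨x, hx, hxy⟩, hyZ⟩
    rw [← hform2 y (fun h => hyZ (hNZ h))]
    constructor
    · unfold omegaFn
      refine le_trans ?_ (ENNReal.le_tsum (⟨x, hx.1, hxy, hx.2.1, hDpos x hx⟩ : {x : EuclideanSpace ℝ (Fin n) // x ∈ U ∧ u x = y ∧ DifferentiableAt ℝ u x ∧ 0 < detD u x}))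
      rw [one_div]
      exact ENNReal.ofReal_le_ofReal (inv_anti₀ (hDpos x hx) hx.2.2.2)
    · have hcard : (U ∩ u ⁻¹' {y}).encard ≤ (m : ℕ∞) := by
        by_contra hc
        exact hyZ (hMZ hc)
      unfold omegaFn
      calc _ ≤ ∑' x : {x : EuclideanSpace ℝ (Fin n) | x ∈ U ∧ u x = y ∧ DifferentiableAt ℝ u x ∧ 0 < detD u x},
            ENNReal.ofReal lam⁻¹ := by
            refine ENNReal.tsum_le_tsum fun x' => ?_
            obtain ⟨x', h1, h2, h3, h4⟩ := x'
            apply ENNReal.ofReal_le_ofReal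
            refine inv_anti₀ hlam ?_
            by_contra hc
            exact hyZ (hNZ ⟨x', ⟨h1, fun hD' => hc hD'.2.2.1⟩, h2⟩)
        _ = _ := ENNReal.tsum_set_const _ _
        _ ≤ (m : ENNReal) * ENNReal.ofReal lam⁻¹ := by
            refine mul_le_mul' ?_ le_rfl
            have : ({x : EuclideanSpace ℝ (Fin n) | x ∈ U ∧ u x = y ∧ DifferentiableAt ℝ u x ∧ 0 < detD u x}).encard ≤ (m : ℕ∞) :=
              (encard_le_encard (t := U ∩ u ⁻¹' {y}) (fun x hx => ⟨hx.1, hx.2.1⟩)).trans hcard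
            exact_mod_cast ENat.toENNReal_le.2 this
        _ = _ := by
            rw [div_eq_mul_inv, ENNReal.ofReal_mul (by positivity), ENNReal.ofReal_natCast]
  have hω'E : ∀ y ∈ u '' D \ Z, ENNReal.ofReal (ω' y).toReal = ω' y := fun y hy =>
    ENNReal.ofReal_toReal (ne_top_of_le_ne_top ENNReal.ofReal_ne_top (hbd y hy).2)
  refine ⟨u '' D \ Z, fun y => (ω' y).toReal, hE'm, ?_, ?_, hω'm.ennreal_toReal, ?_, ?_, ?_⟩
  · rintro y ⟨⟨x, hx, hxy⟩, _⟩
    exact ⟨x, hx.1, hxy⟩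
  · refine measure_mono_null ?_ hZ0
    rintro y ⟨⟨x, hx, rfl⟩, hy⟩
    by_contra hc
    apply hy
    refine ⟨⟨x, ?_, rfl⟩, hc⟩
    by_contra hxD
    exact hc (hNZ ⟨x, ⟨hx, hxD⟩, rfl⟩)
  · intro y hy
    refine ⟨?_, ?_, ?_⟩
    · have := (hbd y hy).1
      rw [← hω'E y hy] at this
      exact (ENNReal.ofReal_le_ofReal_iff ENNReal.toReal_nonneg).1 this
    · exact ENNReal.toReal_le_of_le_ofReal (by positivity) (hbd y hy).2
    · rw [hω'E y hy]
      exact hform2 y (fun h => hy.2 (hNZ h))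
  · have h1 := hform1 ((u '' D \ Z)ᶜ.indicator 1) (measurable_one.indicator hE'm.compl)
    have h2 : ∫⁻ y, ((u '' D \ Z)ᶜ.indicator 1 y : ENNReal) * ω' y = 0 := by
      rw [lintegral_eq_zero_iff (show Measurable (fun y => ((u '' D \ Z)ᶜ.indicator 1 y : ENNReal) * ω' y) from (measurable_one.indicator hE'm.compl).mul hω'm)]
      have : ∀ᵐ y : EuclideanSpace ℝ (Fin n), y ∉ Z := by
        rw [ae_iff]; simpa using hZ0
      filter_upwards [this] with y hy
      by_cases hyD : y ∈ u '' D
      · rw [indicator_of_notMem (by simp [hyD, hy])]; simp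
      · rw [hω'off y hyD]; simp
    rw [h2, lintegral_eq_zero_iff (show Measurable (fun x => ((u '' D \ Z)ᶜ.indicator 1 (u x) : ENNReal)) from (measurable_one.indicator hE'm.compl).comp hu.continuous.measurable)] at h1
    filter_upwards [h1] with x hx
    by_contra hc
    have : u x ∈ (u '' D \ Z)ᶜ := hc
    simp only [indicator_of_mem this] at hx
    simp at hx
  · intro h hh
    rw [hform1 h hh, ← lintegral_indicator hE'm]
    apply lintegral_congr_ae
    have : ∀ᵐ y : EuclideanSpace ℝ (Fin n), y ∉ Z := by
      rw [ae_iff]; simpa using hZ0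
    filter_upwards [this] with y hy
    by_cases hyD : y ∈ u '' D
    · rw [indicator_of_mem (show y ∈ u '' D \ Z from ⟨hyD, hy⟩), hω'E y ⟨hyD, hy⟩]
    · rw [hω'off y hyD, indicator_of_notMem (fun hc => hyD hc.1), mul_zero]

theorem transport {n : ℕ} (p : ℝ) (hp : 1 < p) (E' : Set (Fin n → ℝ)) (hE : MeasurableSet E')
    (f₀ : (Fin n → ℝ) → ℝ) (hf₀ : Measurable f₀) (lo hi : ℝ) (hlo : 0 < lo)
    (hb : ∀ y ∈ E', lo ≤ f₀ y ∧ f₀ y ≤ hi) (κ : ℝ) (hκ1 : lo ≤ κ) (hκ2 : κ ≤ hi)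
    (b : Fin n → ℝ) (d : ℝ) (hd : 0 < d)
    (hEc : E' ⊆ Set.pi univ fun i => Icc (b i) (b i + d))
    (hmass : ∫⁻ y in E', ENNReal.ofReal (f₀ y) = ENNReal.ofReal κ * volume E') :
    ∃ T : (Fin n → ℝ) → (Fin n → ℝ), Measurable T ∧
      (∀ x ∈ Set.pi univ fun i => Icc (b i) (b i + d),
        T x ∈ Set.pi univ fun i => Icc (b i) (b i + d)) ∧
      (∀ F : (Fin n → ℝ) → ENNReal, Measurable F →
        ∫⁻ y in E', F (T y) * ENNReal.ofReal (f₀ y) ≤ ENNReal.ofReal κ * ∫⁻ y, F y) ∧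
      (∫⁻ y in E', ‖T y - y‖ₑ ^ p * ENNReal.ofReal (f₀ y) ≤
        knC p n * ((ENNReal.ofReal d ^ p * ENNReal.ofReal lo ^ (1 - p)) *
          ∫⁻ y in E', ‖f₀ y - κ‖ₑ ^ p)) ∧
      (n = 1 → (∃ K, LipschitzWith K T) ∧ ∃ B', MeasurableSet B' ∧
        ∀ F : (Fin n → ℝ) → ENNReal, Measurable F →
        ∫⁻ y in E', F (T y) * ENNReal.ofReal (f₀ y) = ENNReal.ofReal κ * ∫⁻ y in B', F y) := by
  classical
  set Q := Set.pi univ fun i => Icc (b i) (b i + d) with hQ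
  have hQm : MeasurableSet Q := MeasurableSet.univ_pi fun i => measurableSet_Icc
  set f : (Fin n → ℝ) → ℝ := fun y => if y ∈ E' then f₀ y else κ with hf
  have hfm : Measurable f := Measurable.ite hE hf₀ measurable_const
  have hκ : 0 < κ := lt_of_lt_of_le hlo hκ1
  have h1 : ∀ x, lo ≤ f x := fun x => by
    by_cases h : x ∈ E'
    · simp only [hf, h, if_true]; exact (hb x h).1
    · simp only [hf, h, if_false]; exact hκ1
  have h2 : ∀ x, f x ≤ hi := fun x => by
    by_cases h : x ∈ E'
    · simp only [hf, h, if_true]; exact (hb x h).2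
    · simp only [hf, h, if_false]; exact hκ2
  have split : ∀ G : (Fin n → ℝ) → ENNReal, ∫⁻ x in Q, G x = (∫⁻ x in E', G x) + ∫⁻ x in Q \ E', G x := by
    intro G
    rw [← lintegral_inter_add_diff G Q hE, inter_eq_right.2 hEc]
  have hmass' : ∫⁻ x, ENNReal.ofReal (f x) ∂(cubeM b d) = ENNReal.ofReal κ * cubeM b d univ := by
    rw [cubeM_eq, ← hQ, split, Measure.restrict_apply_univ]
    have e1 : ∫⁻ x in E', ENNReal.ofReal (f x) = ENNReal.ofReal κ * volume E' := by
      rw [← hmass]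
      refine setLIntegral_congr_fun hE fun x hx => ?_
      simp only [hf, hx, if_true]
    have e2 : ∫⁻ x in Q \ E', ENNReal.ofReal (f x) = ENNReal.ofReal κ * volume (Q \ E') := by
      rw [← setLIntegral_const]
      refine setLIntegral_congr_fun (hQm.diff hE) fun x hx => ?_
      have := hx.2
      simp only [hf, this, if_false]
    rw [e1, e2, ← mul_add, ← measure_inter_add_diff Q hE, inter_eq_right.2 hEc]
  obtain ⟨T, hTm, hTQ, hTF, hTc, hT1⟩ := knothe b d hd hfm hlo h1 h2 p hp κ hκ hmass'
  rw [cubeM_eq, ← hQ] at hTc hTF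
  have hle : ∀ F : (Fin n → ℝ) → ENNReal, ∫⁻ y in E', F y * ENNReal.ofReal (f₀ y) ≤
      ∫⁻ y in Q, F y * ENNReal.ofReal (f y) := by
    intro F
    rw [split]
    refine le_trans (le_of_eq ?_) le_self_add
    refine setLIntegral_congr_fun hE fun x hx => ?_
    simp only [hf, hx, if_true]
  refine ⟨T, hTm, hTQ, ?_, ?_, ?_⟩
  · intro F hF
    refine (hle (fun y => F (T y))).trans ?_
    rw [hTF F hF]
    exact mul_le_mul' le_rfl (setLIntegral_le_lintegral _ _)
  · refine (hle (fun y => ‖T y - y‖ₑ ^ p)).trans (hTc.trans (le_of_eq ?_))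
    congr 2
    rw [split]
    have e2 : ∫⁻ x in Q \ E', ‖f x - κ‖ₑ ^ p = 0 := by
      rw [← lintegral_zero (μ := volume.restrict (Q \ E'))]
      refine setLIntegral_congr_fun (hQm.diff hE) fun x hx => ?_
      have := hx.2
      simp only [hf, this, if_false]
      simp [ENNReal.zero_rpow_of_pos (lt_trans one_pos hp)]
    rw [e2, add_zero]
    refine setLIntegral_congr_fun hE fun x hx => ?_
    simp only [hf, hx, if_true]
  · intro hn1
    obtain ⟨⟨K, hK⟩, hinj⟩ := hT1 hn1
    have hBm : MeasurableSet (T '' E') :=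
      hE.image_of_continuousOn_injOn hK.continuous.continuousOn hinj.injOn
    refine ⟨⟨K, hK⟩, T '' E', hBm, fun F hF => ?_⟩
    have h3 := hTF ((T '' E').indicator F) (hF.indicator hBm)
    have hsub : T '' E' ⊆ Q := by
      rintro _ ⟨x, hx, rfl⟩
      exact hTQ x (hEc hx)
    rw [lintegral_indicator hBm, Measure.restrict_restrict hBm, inter_eq_left.2 hsub] at h3
    rw [← h3, ← lintegral_indicator hE, ← lintegral_indicator hQm]
    congr 1
    ext y
    by_cases hy : y ∈ E'
    · rw [indicator_of_mem hy, indicator_of_mem (hEc hy), indicator_of_mem (mem_image_of_mem T hy)]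
      simp only [hf, hy, if_true]
    · rw [indicator_of_notMem hy]
      have : T y ∉ T '' E' := by
        rintro ⟨z, hz, hzy⟩
        exact hy (hinj hzy ▸ hz)
      by_cases hq : y ∈ Q
      · rw [indicator_of_mem hq, indicator_of_notMem this, zero_mul]
      · rw [indicator_of_notMem hq]

theorem smul_vol {n : ℕ} (κ c : ℝ) (hκ : 0 < κ) (hc : 0 < c) (hcn : c ^ n = κ⁻¹)
    (S : Set (Fin n → ℝ)) :
    ENNReal.ofReal κ * volume ((fun x : Fin n → ℝ => c⁻¹ • x) ⁻¹' S) = volume S := by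
  rw [Measure.addHaar_preimage_smul volume (inv_ne_zero hc.ne'), ← mul_assoc,
    ← ENNReal.ofReal_mul hκ.le]
  simp only [Module.finrank_fin_fun, inv_pow, inv_inv, hcn]
  rw [abs_of_pos (by positivity), mul_inv_cancel₀ hκ.ne']
  simp

theorem direct {n : ℕ} (U E' : Set (Fin n → ℝ)) (f₀ : (Fin n → ℝ) → ℝ)
    (v : (Fin n → ℝ) → (Fin n → ℝ)) (K : NNReal) (hv : LipschitzWith K v)
    (hform : ∀ h : (Fin n → ℝ) → ENNReal, Measurable h →
        ∫⁻ x in U, h (v x) = ∫⁻ y in E', h y * ENNReal.ofReal (f₀ y))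
    (κ c : ℝ) (hκ : 0 < κ) (hc : 0 < c) (hcn : c ^ n = κ⁻¹)
    (T : (Fin n → ℝ) → (Fin n → ℝ)) (K' : NNReal) (hT : LipschitzWith K' T)
    (B' : Set (Fin n → ℝ)) (hB' : MeasurableSet B')
    (hTB : ∀ F : (Fin n → ℝ) → ENNReal, Measurable F →
        ∫⁻ y in E', F (T y) * ENNReal.ofReal (f₀ y) = ENNReal.ofReal κ * ∫⁻ y in B', F y) :
    ∃ s : (Fin n → ℝ) → (Fin n → ℝ), (∃ Ks, LipschitzWith Ks s) ∧
      (∃ B, MeasurableSet B ∧ Measure.map s (volume.restrict U) = volume.restrict B) ∧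
      ∀ x, c • s x = T (v x) := by
  have hsl : LipschitzWith (‖c⁻¹‖₊ * (K' * K)) (fun x => c⁻¹ • T (v x)) :=
    (lipschitzWith_smul c⁻¹).comp (hT.comp hv)
  refine ⟨fun x => c⁻¹ • T (v x), ⟨_, hsl⟩, ⟨(fun x : Fin n → ℝ => c • x) ⁻¹' B',
    (measurable_const_smul c) hB', ?_⟩, fun x => smul_inv_smul₀ hc.ne' _⟩
  ext S hS
  rw [Measure.map_apply hsl.continuous.measurable hS, Measure.restrict_apply hS]
  have hm1 : Measurable (fun y : Fin n → ℝ => c⁻¹ • y) := measurable_const_smul c⁻¹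
  have e1 : (volume.restrict U) ((fun x => c⁻¹ • T (v x)) ⁻¹' S)
      = ∫⁻ x in U, S.indicator 1 (c⁻¹ • T (v x)) := by
    rw [← lintegral_indicator_one (hsl.continuous.measurable hS)]
    rfl
  rw [e1, hform (fun y => S.indicator 1 (c⁻¹ • T y))
    ((measurable_one.indicator hS).comp (hm1.comp hT.continuous.measurable)),
    hTB (fun y => S.indicator 1 (c⁻¹ • y)) ((measurable_one.indicator hS).comp hm1)]
  have e2 : ∫⁻ y in B', S.indicator 1 (c⁻¹ • y) =
      volume ((fun x : Fin n → ℝ => c⁻¹ • x) ⁻¹' (S ∩ (fun x : Fin n → ℝ => c • x) ⁻¹' B')) := by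
    have : (fun x : Fin n → ℝ => c⁻¹ • x) ⁻¹' (S ∩ (fun x : Fin n → ℝ => c • x) ⁻¹' B')
      = ((fun x : Fin n → ℝ => c⁻¹ • x) ⁻¹' S) ∩ B' := by
      ext x
      simp [smul_inv_smul₀ hc.ne']
    rw [this, ← Measure.restrict_apply (hm1 hS), ← lintegral_indicator_one (hm1 hS)]
    rfl
  rw [e2, smul_vol κ c hκ hc hcn]

theorem cost2_pt (p : ℝ) (hp : 1 < p) (κ f hi : ℝ) (hκ : 0 < κ) (hf : 0 < f) (hhi : f ≤ hi) :
    ‖f - κ‖ₑ ^ p ≤ ENNReal.ofReal (κ ^ p * hi ^ (p - 1)) * (‖κ⁻¹ - f⁻¹‖ₑ ^ p * ENNReal.ofReal f) := by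
  have e : ∀ a : ℝ, ‖a‖ₑ ^ p = ENNReal.ofReal (|a| ^ p) := fun a => by
    rw [← ofReal_norm, ENNReal.ofReal_rpow_of_nonneg (norm_nonneg _) (by linarith), Real.norm_eq_abs]
  have hhi0 : 0 < hi := lt_of_lt_of_le hf hhi
  rw [e, e, ← ENNReal.ofReal_mul (by positivity), ← ENNReal.ofReal_mul (by positivity)]
  apply ENNReal.ofReal_le_ofReal
  have h1 : |f - κ| = κ * f * |κ⁻¹ - f⁻¹| := by
    have : f - κ = κ * f * (κ⁻¹ - f⁻¹) := by field_simp
    rw [this, abs_mul, abs_of_pos (by positivity)]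
  rw [h1, Real.mul_rpow (by positivity) (by positivity), Real.mul_rpow hκ.le hf.le]
  have h2 : f ^ p = f ^ (p - 1) * f := by
    rw [← Real.rpow_add_one hf.ne']; congr 1; ring
  have h3 : f ^ (p - 1) ≤ hi ^ (p - 1) := Real.rpow_le_rpow hf.le hhi (by linarith)
  rw [h2]
  calc κ ^ p * (f ^ (p - 1) * f) * |κ⁻¹ - f⁻¹| ^ p
      = (κ ^ p * (|κ⁻¹ - f⁻¹| ^ p * f)) * f ^ (p - 1) := by ring
    _ ≤ (κ ^ p * (|κ⁻¹ - f⁻¹| ^ p * f)) * hi ^ (p - 1) :=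
        mul_le_mul_of_nonneg_left h3 (by positivity)
    _ = _ := by ring

theorem main_pi {n : ℕ} (hn : 1 ≤ n) (p : ℝ) (hp : 1 < p) (U E' : Set (Fin n → ℝ)) (hUo : IsOpen U)
    (hUb : IsBounded U) (hU0 : U.Nonempty)
    (f₀ : (Fin n → ℝ) → ℝ) (hf₀ : Measurable f₀) (lo hi : ℝ) (hlo : 0 < lo)
    (hb : ∀ y ∈ E', lo ≤ f₀ y ∧ f₀ y ≤ hi) (hE : MeasurableSet E')
    (v : (Fin n → ℝ) → (Fin n → ℝ)) (K : NNReal) (hv : LipschitzWith K v)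
    (hform : ∀ h : (Fin n → ℝ) → ENNReal, Measurable h →
        ∫⁻ x in U, h (v x) = ∫⁻ y in E', h y * ENNReal.ofReal (f₀ y))
    (hvE : ∀ᵐ x ∂(volume.restrict U), v x ∈ E')
    (b : Fin n → ℝ) (d : ℝ) (hd : 0 < d)
    (hEv : E' ⊆ v '' U)
    (hvc : ∀ x ∈ U, v x ∈ Set.pi univ fun i => Icc (b i) (b i + d))
    (κ c : ℝ) (hκ : 0 < κ) (hc : 0 < c) (hcn : c ^ n = κ⁻¹)
    (hvol : volume U = ENNReal.ofReal κ * volume E') :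
    lo ≤ κ ∧ κ ≤ hi ∧
    ∃ s : (Fin n → ℝ) → (Fin n → ℝ), (∃ Ks, LipschitzWith Ks s) ∧
      (∃ B, MeasurableSet B ∧ Measure.map s (volume.restrict U) = volume.restrict B) ∧
      ∫⁻ x in U, ‖v x - c • s x‖ₑ ^ p ≤ (2 ^ p * 2 ^ p + 1) * (knC p n + 1) *
        ((ENNReal.ofReal d ^ p * ENNReal.ofReal lo ^ (1 - p)) *
          (ENNReal.ofReal (κ ^ p * hi ^ (p - 1)) *
            ∫⁻ x in U, ‖κ⁻¹ - (f₀ (v x))⁻¹‖ₑ ^ p)) := by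
  have hp0 : 0 < p := by linarith
  have hUtop : volume U ≠ ⊤ := hUb.measure_lt_top.ne
  have hUpos : volume U ≠ 0 := (hUo.measure_pos volume hU0).ne'
  have hEpos : volume E' ≠ 0 := by
    intro h; rw [h, mul_zero] at hvol; exact hUpos hvol
  have hEtop : volume E' ≠ ⊤ := by
    intro h; rw [h, ENNReal.mul_top (by simpa using hκ)] at hvol; exact hUtop hvol
  have hEc : E' ⊆ Set.pi univ fun i => Icc (b i) (b i + d) := by
    intro y hy
    obtain ⟨x, hx, rfl⟩ := hEv hy
    exact hvc x hx
  have hmass : ∫⁻ y in E', ENNReal.ofReal (f₀ y) = ENNReal.ofReal κ * volume E' := by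
    have := hform (fun _ => 1) measurable_const
    simp only [one_mul] at this
    rw [← this, ← hvol]; simp
  have hEne : E'.Nonempty := by
    rw [nonempty_iff_ne_empty]; rintro rfl; simp at hEpos
  have hhi : 0 < hi := by
    obtain ⟨y, hy⟩ := hEne
    linarith [hb y hy]
  have hκ1 : lo ≤ κ := by
    have h1 : ENNReal.ofReal lo * volume E' ≤ ENNReal.ofReal κ * volume E' := by
      rw [← hmass, ← setLIntegral_const]
      exact setLIntegral_mono' hE fun y hy => ENNReal.ofReal_le_ofReal (hb y hy).1
    have := (ENNReal.mul_le_mul_iff_left hEpos hEtop).1 h1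
    exact (ENNReal.ofReal_le_ofReal_iff hκ.le).1 this
  have hκ2 : κ ≤ hi := by
    have h1 : ENNReal.ofReal κ * volume E' ≤ ENNReal.ofReal hi * volume E' := by
      rw [← hmass, ← setLIntegral_const]
      exact setLIntegral_mono' hE fun y hy => ENNReal.ofReal_le_ofReal (hb y hy).2
    have := (ENNReal.mul_le_mul_iff_left hEpos hEtop).1 h1
    exact (ENNReal.ofReal_le_ofReal_iff hhi.le).1 this
  refine ⟨hκ1, hκ2, ?_⟩
  have hvm : Measurable v := hv.continuous.measurable
  set I := ∫⁻ x in U, ‖κ⁻¹ - (f₀ (v x))⁻¹‖ₑ ^ p with hI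
  have hGm : Measurable fun y => ‖κ⁻¹ - (f₀ y)⁻¹‖ₑ ^ p :=
    ((measurable_const.sub hf₀.inv).enorm).pow_const p
  have hI' : I = ∫⁻ y in E', ‖κ⁻¹ - (f₀ y)⁻¹‖ₑ ^ p * ENNReal.ofReal (f₀ y) :=
    hform (fun y => ‖κ⁻¹ - (f₀ y)⁻¹‖ₑ ^ p) hGm
  have hcost2 : ∫⁻ y in E', ‖f₀ y - κ‖ₑ ^ p ≤ ENNReal.ofReal (κ ^ p * hi ^ (p - 1)) * I := by
    rw [hI', ← lintegral_const_mul _ (show Measurable (fun y => ‖κ⁻¹ - (f₀ y)⁻¹‖ₑ ^ p * ENNReal.ofReal (f₀ y))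
      from hGm.mul hf₀.ennreal_ofReal)]
    exact setLIntegral_mono' hE fun y hy =>
      cost2_pt p hp κ (f₀ y) hi hκ (lt_of_lt_of_le hlo (hb y hy).1) (hb y hy).2
  set A := (ENNReal.ofReal d ^ p * ENNReal.ofReal lo ^ (1 - p)) *
          (ENNReal.ofReal (κ ^ p * hi ^ (p - 1)) * I) with hA
  have h4 : (1 : ENNReal) ≤ 2 ^ p * 2 ^ p + 1 := le_add_self
  have hkn : knC p n ≤ knC p n + 1 := le_self_add
  by_cases hI0 : I = 0
  · -- trivial case
    have hκae : ∀ᵐ y ∂(volume.restrict E'), f₀ y = κ := by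
      have h0 : ∫⁻ y in E', ‖f₀ y - κ‖ₑ ^ p = 0 := by
        rw [hI0, mul_zero] at hcost2; exact le_antisymm hcost2 zero_le
      rw [lintegral_eq_zero_iff (show Measurable (fun y => ‖f₀ y - κ‖ₑ ^ p)
        from (hf₀.sub_const κ).enorm.pow_const p)] at h0
      filter_upwards [h0] with y hy
      have : ‖f₀ y - κ‖ₑ = 0 := by
        simpa [ENNReal.rpow_eq_zero_iff, hp0, not_lt.2 hp0.le] using hy
      rw [enorm_eq_zero] at this
      linarith
    obtain ⟨s, hs1, hs2, hs3⟩ := direct U E' f₀ v K hv hform κ c hκ hc hcn id 1 LipschitzWith.id E' hE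
      (by
        intro F hF
        rw [← lintegral_const_mul _ hF]
        apply lintegral_congr_ae
        filter_upwards [hκae] with y hy
        rw [hy, mul_comm]; rfl)
    refine ⟨s, hs1, hs2, ?_⟩
    have : ∫⁻ x in U, ‖v x - c • s x‖ₑ ^ p = 0 := by
      simp [hs3, ENNReal.zero_rpow_of_pos hp0]
    rw [this]; exact zero_le
  obtain ⟨T, hTm, hTQ, hTF, hTc, hT1⟩ := transport p hp E' hE f₀ hf₀ lo hi hlo hb κ hκ1 hκ2 b d hd hEc hmass
  have hcost : ∫⁻ x in U, ‖v x - T (v x)‖ₑ ^ p ≤ knC p n * A := by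
    rw [hform (fun y => ‖y - T y‖ₑ ^ p) ((measurable_id.sub hTm).enorm.pow_const p)]
    calc _ = ∫⁻ y in E', ‖T y - y‖ₑ ^ p * ENNReal.ofReal (f₀ y) := by
          refine lintegral_congr fun y => ?_
          rw [enorm_sub_rev]
      _ ≤ _ := hTc
      _ ≤ _ := mul_le_mul' le_rfl (mul_le_mul' le_rfl hcost2)
  by_cases hn1 : n = 1
  · obtain ⟨⟨K', hK'⟩, B', hB', hTB⟩ := hT1 hn1
    obtain ⟨s, hs1, hs2, hs3⟩ := direct U E' f₀ v K hv hform κ c hκ hc hcn T K' hK' B' hB' hTB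
    refine ⟨s, hs1, hs2, ?_⟩
    simp only [hs3]
    refine hcost.trans (mul_le_mul' ?_ le_rfl)
    calc knC p n ≤ 1 * (knC p n + 1) := by rw [one_mul]; exact hkn
      _ ≤ _ := mul_le_mul' h4 le_rfl
  have hn2 : 2 ≤ n := by omega
  have hA0 : A ≠ 0 := by
    have h1 : ENNReal.ofReal d ^ p ≠ 0 := by
      simp [ENNReal.rpow_eq_zero_iff, hd, hp0.le]
    have h2 : ENNReal.ofReal lo ^ (1 - p) ≠ 0 := by
      simp [ENNReal.rpow_eq_zero_iff, hlo]
    have h3 : ENNReal.ofReal (κ ^ p * hi ^ (p - 1)) ≠ 0 := by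
      have : 0 < κ ^ p * hi ^ (p - 1) := by positivity
      simpa using this
    exact mul_ne_zero (mul_ne_zero h1 h2) (mul_ne_zero h3 hI0)
  set cp := ENNReal.ofReal c ^ p with hcp
  have hcp0 : cp ≠ 0 := by simp [hcp, ENNReal.rpow_eq_zero_iff, hc, hp0.le]
  have hcpt : cp ≠ ⊤ := by simp [hcp, ENNReal.rpow_eq_top_iff, hp0.le]
  -- box
  obtain ⟨R₁, hR₁⟩ := hUb.exists_norm_le
  have hQb : IsBounded ((fun y : Fin n → ℝ => c⁻¹ • y) '' (Set.pi univ fun i => Icc (b i) (b i + d))) := by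
    have : IsCompact (Set.pi univ fun i => Icc (b i) (b i + d)) := isCompact_univ_pi fun i => isCompact_Icc
    exact (this.image (continuous_const_smul c⁻¹)).isBounded
  obtain ⟨R₂, hR₂⟩ := hQb.exists_norm_le
  set R := max (max R₁ R₂) 0 + 1 with hR
  have hRpos : 0 < R := by positivity
  have hR₁R : R₁ < R := lt_of_le_of_lt ((le_max_left _ _).trans (le_max_left _ _)) (lt_add_one _)
  have hR₂R : R₂ < R := lt_of_le_of_lt ((le_max_right _ _).trans (le_max_left _ _)) (lt_add_one _)
  have hbox : ∀ z : Fin n → ℝ, ‖z‖ < R → ∀ i, z i ∈ Ico (-R) R := by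
    intro z hz i
    have h1 : |z i| < R := lt_of_le_of_lt (norm_le_pi_norm z i) hz
    rw [abs_lt] at h1
    exact ⟨h1.1.le, h1.2⟩
  have hwl : LipschitzWith (‖c⁻¹‖₊ * K) (fun x => c⁻¹ • v x) := (lipschitzWith_smul c⁻¹).comp hv
  have hσm : Measurable (fun x => c⁻¹ • T (v x)) := (measurable_const_smul c⁻¹).comp (hTm.comp hvm)
  have hm1 : Measurable (fun y : Fin n → ℝ => c⁻¹ • y) := measurable_const_smul c⁻¹
  have hmap : Measure.map (fun x => c⁻¹ • T (v x)) (volume.restrict U) ≤ volume := by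
    refine Measure.le_iff.2 fun S hS => ?_
    rw [Measure.map_apply hσm hS]
    have e1 : (volume.restrict U) ((fun x => c⁻¹ • T (v x)) ⁻¹' S)
        = ∫⁻ x in U, S.indicator 1 (c⁻¹ • T (v x)) := by
      rw [← lintegral_indicator_one (hσm hS)]
      rfl
    rw [e1, hform (fun y => S.indicator 1 (c⁻¹ • T y))
      ((measurable_one.indicator hS).comp (hm1.comp hTm))]
    refine (hTF (fun y => S.indicator 1 (c⁻¹ • y)) ((measurable_one.indicator hS).comp hm1)).trans ?_
    have e2 : ∫⁻ y, S.indicator 1 (c⁻¹ • y) = volume ((fun x : Fin n → ℝ => c⁻¹ • x) ⁻¹' S) := by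
      rw [← lintegral_indicator_one (hm1 hS)]
      rfl
    rw [e2, smul_vol κ c hκ hc hcn]
  obtain ⟨g, hg, ⟨K', hK'⟩, hgc⟩ := lemM hn2 p hp U hUo R hRpos
    (fun x hx => hbox x (lt_of_le_of_lt (hR₁ x hx) hR₁R)) (fun x => c⁻¹ • v x)
    (fun x => c⁻¹ • T (v x)) _ hwl R hRpos.le
    (fun x hx => ((hR₂ _ ⟨v x, hvc x hx, rfl⟩).trans hR₂R.le)) hσm
    (fun x hx => hbox _ (lt_of_le_of_lt (hR₂ _ ⟨T (v x), hTQ _ (hvc x hx), rfl⟩) hR₂R)) hmap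
    (A / cp) (ENNReal.div_ne_zero.2 ⟨hA0, hcpt⟩)
  have hscale : ∀ z : Fin n → ℝ, ‖c • z‖ₑ ^ p = cp * ‖z‖ₑ ^ p := by
    intro z
    rw [enorm_smul, ENNReal.mul_rpow_of_nonneg _ _ hp0.le, hcp, Real.enorm_eq_ofReal hc.le]
  refine ⟨g, ⟨K', hK'⟩, ⟨g '' U, g.measurableEmbedding.measurableSet_image.2 hUo.measurableSet, ?_⟩, ?_⟩
  · have h1 := hg.restrict_image_emb g.measurableEmbedding U
    exact h1.map_eq
  · have e1 : ∫⁻ x in U, ‖v x - c • g x‖ₑ ^ p = cp * ∫⁻ x in U, ‖c⁻¹ • v x - g x‖ₑ ^ p := by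
      rw [← lintegral_const_mul' _ _ hcpt]
      refine lintegral_congr fun x => ?_
      rw [← hscale, smul_sub, smul_inv_smul₀ hc.ne']
    have e2 : cp * ∫⁻ x in U, ‖c⁻¹ • v x - c⁻¹ • T (v x)‖ₑ ^ p = ∫⁻ x in U, ‖v x - T (v x)‖ₑ ^ p := by
      rw [← lintegral_const_mul' _ _ hcpt]
      refine lintegral_congr fun x => ?_
      rw [← hscale, smul_sub, smul_inv_smul₀ hc.ne', smul_inv_smul₀ hc.ne']
    rw [e1]
    calc _ ≤ cp * (2 ^ p * 2 ^ p * (∫⁻ x in U, ‖c⁻¹ • v x - c⁻¹ • T (v x)‖ₑ ^ p) + A / cp) :=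
          mul_le_mul' le_rfl hgc
      _ = 2 ^ p * 2 ^ p * (cp * ∫⁻ x in U, ‖c⁻¹ • v x - c⁻¹ • T (v x)‖ₑ ^ p) + A := by
          rw [mul_add, ENNReal.mul_div_cancel hcp0 hcpt]
          ring
      _ ≤ 2 ^ p * 2 ^ p * ((knC p n + 1) * A) + (knC p n + 1) * A := by
          rw [e2]
          refine add_le_add (mul_le_mul' le_rfl (hcost.trans (mul_le_mul' hkn le_rfl))) ?_
          calc A = 1 * A := (one_mul A).symm
            _ ≤ _ := mul_le_mul' le_add_self le_rfl
      _ = _ := by ring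

/-- main estimate on Euclidean space, in terms of lower integrals -/
theorem main_euc {n : ℕ} (hn : 1 ≤ n) (p : ℝ) (hp : 1 < p) (U E' : Set (EuclideanSpace ℝ (Fin n)))
    (hUo : IsOpen U) (hUb : IsBounded U) (hU0 : U.Nonempty)
    (f₀ : EuclideanSpace ℝ (Fin n) → ℝ) (hf₀ : Measurable f₀) (lo hi : ℝ) (hlo : 0 < lo)
    (hb : ∀ y ∈ E', lo ≤ f₀ y ∧ f₀ y ≤ hi) (hE : MeasurableSet E')
    (u : EuclideanSpace ℝ (Fin n) → EuclideanSpace ℝ (Fin n)) (K : NNReal) (hu : LipschitzWith K u)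
    (hform : ∀ h : EuclideanSpace ℝ (Fin n) → ENNReal, Measurable h →
        ∫⁻ x in U, h (u x) = ∫⁻ y in E', h y * ENNReal.ofReal (f₀ y))
    (huE : ∀ᵐ x ∂(volume.restrict U), u x ∈ E')
    (d : ℝ) (hd : 0 < d) (hEu : E' ⊆ u '' U) (hub : IsBounded (u '' U))
    (hdiam : diam (u '' U) ≤ d)
    (κ c : ℝ) (hκ : 0 < κ) (hc : 0 < c) (hcn : c ^ n = κ⁻¹)
    (hvol : volume U = ENNReal.ofReal κ * volume E') :
    κ ≤ hi ∧
    ∃ s : EuclideanSpace ℝ (Fin n) → EuclideanSpace ℝ (Fin n), (∃ Ks, LipschitzWith Ks s) ∧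
      (∃ B, MeasurableSet B ∧ Measure.map s (volume.restrict U) = volume.restrict B) ∧
      ∫⁻ x in U, ‖u x - c • s x‖ₑ ^ p ≤
        ((((Fintype.card (Fin n) : NNReal) ^ (1 / (2 : ENNReal)).toReal : NNReal) : ENNReal) ^ p *
          ((2 ^ p * 2 ^ p + 1) * (knC p n + 1))) *
        ((ENNReal.ofReal d ^ p * ENNReal.ofReal lo ^ (1 - p)) *
          (ENNReal.ofReal (κ ^ p * hi ^ (p - 1)) *
            ∫⁻ x in U, ‖κ⁻¹ - (f₀ (u x))⁻¹‖ₑ ^ p)) := by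
  have hp0 : 0 < p := by linarith
  set e : (Fin n → ℝ) → EuclideanSpace ℝ (Fin n) := WithLp.toLp 2 with he
  set o : EuclideanSpace ℝ (Fin n) → (Fin n → ℝ) := WithLp.ofLp with ho
  have hoe : ∀ x, o (e x) = x := fun x => rfl
  have heo : ∀ x, e (o x) = x := fun x => rfl
  have heL : LipschitzWith ((Fintype.card (Fin n) : NNReal) ^ (1 / (2 : ENNReal)).toReal) e :=
    PiLp.lipschitzWith_toLp 2 (fun _ : Fin n => ℝ)
  have hoL : LipschitzWith 1 o := PiLp.lipschitzWith_ofLp 2 (fun _ : Fin n => ℝ)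
  have hemp : MeasurePreserving e volume volume := PiLp.volume_preserving_toLp (Fin n)
  have homp : MeasurePreserving o volume volume := PiLp.volume_preserving_ofLp (Fin n)
  have heemb : MeasurableEmbedding e := (MeasurableEquiv.toLp 2 (Fin n → ℝ)).measurableEmbedding
  have hoemb : MeasurableEmbedding o := (MeasurableEquiv.toLp 2 (Fin n → ℝ)).symm.measurableEmbedding
  have hem : Measurable e := heL.continuous.measurable
  have hom : Measurable o := hoL.continuous.measurable
  have hintg : ∀ (S : Set (EuclideanSpace ℝ (Fin n))) (F : EuclideanSpace ℝ (Fin n) → ENNReal),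
      ∫⁻ x in e ⁻¹' S, F (e x) = ∫⁻ x in S, F x := fun S F =>
    hemp.setLIntegral_comp_preimage_emb heemb F S
  have hvolp : ∀ S : Set (EuclideanSpace ℝ (Fin n)), volume (e ⁻¹' S) = volume S := fun S =>
    hemp.measure_preimage_emb heemb S
  have hUb' : IsBounded (e ⁻¹' U) := by
    have : e ⁻¹' U = o '' U := by
      ext x
      constructor
      · intro h; exact ⟨e x, h, rfl⟩
      · rintro ⟨y, hy, rfl⟩; exact hy
    rw [this]
    exact hoL.isBounded_image hUb
  have hcoord : ∀ x ∈ U, ∀ z ∈ U, ∀ i, o (u x) i - o (u z) i ≤ d := by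
    intro x hx z hz i
    have h1 : dist (u x) (u z) ≤ d :=
      (dist_le_diam_of_mem hub (mem_image_of_mem u hx) (mem_image_of_mem u hz)).trans hdiam
    have h2 : ‖(u x - u z).ofLp i‖ ≤ ‖u x - u z‖ := PiLp.norm_apply_le _ i
    rw [dist_eq_norm] at h1
    have h3 : |o (u x) i - o (u z) i| ≤ d := h2.trans h1
    exact (le_abs_self _).trans h3
  set b : Fin n → ℝ := fun i => sInf ((fun x => o (u x) i) '' U) with hbdef
  obtain ⟨x₀, hx₀⟩ := hU0
  have hbdd : ∀ i, BddBelow ((fun x => o (u x) i) '' U) := by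
    intro i
    refine ⟨o (u x₀) i - d, ?_⟩
    rintro _ ⟨x, hx, rfl⟩
    have := hcoord x₀ hx₀ x hx i
    simp only
    linarith
  have hvc : ∀ x ∈ e ⁻¹' U, o (u (e x)) ∈ Set.pi univ fun i => Icc (b i) (b i + d) := by
    intro x hx i _
    refine ⟨csInf_le (hbdd i) ⟨e x, hx, rfl⟩, ?_⟩
    have : o (u (e x)) i - d ≤ b i := by
      refine le_csInf ⟨_, x₀, hx₀, rfl⟩ ?_
      rintro _ ⟨z, hz, rfl⟩
      have := hcoord (e x) hx z hz i
      simp only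
      linarith
    linarith
  obtain ⟨_, hκ2, s', ⟨Ks, hKs⟩, ⟨B, hB, hmap⟩, hcost⟩ := main_pi hn p hp (e ⁻¹' U) (e ⁻¹' E')
    (hUo.preimage heL.continuous) hUb' ⟨o x₀, hx₀⟩ (fun y => f₀ (e y)) (hf₀.comp hem) lo hi hlo
    (fun y hy => hb (e y) hy) (hem hE) (fun x => o (u (e x))) _ (hoL.comp (hu.comp heL))
    (by
      intro h hh
      rw [hintg U (fun x => h (o (u x))), hform (fun y => h (o y)) (hh.comp hom), ← hintg E'])
    (by
      have := (hemp.restrict_preimage_emb heemb U).quasiMeasurePreserving.ae huE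
      filter_upwards [this] with x hx
      exact hx)
    b d hd
    (by
      intro y hy
      obtain ⟨x, hx, hxy⟩ := hEu hy
      exact ⟨o x, hx, by simp only [heo, hxy, hoe]⟩)
    hvc κ c hκ hc hcn (by rw [hvolp, hvolp]; exact hvol)
  refine ⟨hκ2, fun x => e (s' (o x)), ⟨_, heL.comp (hKs.comp hoL)⟩, ⟨o ⁻¹' B, hom hB, ?_⟩, ?_⟩
  · have h1 : Measure.map o (volume.restrict U) = volume.restrict (e ⁻¹' U) :=
      (homp.restrict_preimage_emb hoemb (e ⁻¹' U)).map_eq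
    have h2 : Measure.map e (volume.restrict B) = volume.restrict (o ⁻¹' B) :=
      (hemp.restrict_preimage_emb heemb (o ⁻¹' B)).map_eq
    rw [← h2, ← hmap, ← h1, Measure.map_map hKs.continuous.measurable hom,
      Measure.map_map hem (hKs.continuous.measurable.comp hom)]
    rfl
  · set L : NNReal := (Fintype.card (Fin n) : NNReal) ^ (1 / (2 : ENNReal)).toReal with hL
    rw [← hintg U, ← hintg U (fun x => ‖κ⁻¹ - (f₀ (u x))⁻¹‖ₑ ^ p)]
    have hpt : ∀ x, ‖u (e x) - c • e (s' (o (e x)))‖ₑ ^ p ≤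
        (L : ENNReal) ^ p * ‖o (u (e x)) - c • s' x‖ₑ ^ p := by
      intro x
      rw [← ENNReal.mul_rpow_of_nonneg _ _ hp0.le]
      refine ENNReal.rpow_le_rpow ?_ hp0.le
      have h1 := heL (o (u (e x))) (c • s' x)
      rw [edist_eq_enorm_sub, edist_eq_enorm_sub] at h1
      exact h1
    have hLt : (L : ENNReal) ^ p ≠ ⊤ := by
      simp [ENNReal.rpow_eq_top_iff, hp0.le]
    calc _ ≤ ∫⁻ x in e ⁻¹' U, (L : ENNReal) ^ p * ‖o (u (e x)) - c • s' x‖ₑ ^ p :=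
          lintegral_mono hpt
      _ = (L : ENNReal) ^ p * ∫⁻ x in e ⁻¹' U, ‖o (u (e x)) - c • s' x‖ₑ ^ p :=
          lintegral_const_mul' _ _ hLt
      _ ≤ _ := mul_le_mul' le_rfl hcost
      _ = _ := by
          rw [mul_assoc ((L : ENNReal) ^ p)]

theorem const_ineq (p : ℝ) (hp : 1 < p) (m d lam Lam κ : ℝ) (hm : 1 ≤ m) (hd : 0 < d) (hlam : 0 < lam)
    (hLam : lam ≤ Lam) (hκ : 0 < κ) (hκ2 : κ ≤ m / lam) :
    d ^ p * (1 / Lam) ^ (1 - p) * (κ ^ p * (m / lam) ^ (p - 1)) ≤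
      m ^ (3 * p - 2) * (d / lam) ^ p * (Lam / lam) ^ (2 * p - 2) := by
  have hL : 0 < Lam := lt_of_lt_of_le hlam hLam
  have hm0 : 0 < m := by linarith
  have h1 : (1 / Lam) ^ (1 - p) = Lam ^ (p - 1) := by
    rw [one_div, Real.inv_rpow hL.le, ← Real.rpow_neg hL.le]; congr 1; ring
  have h2 : κ ^ p ≤ (m / lam) ^ p := Real.rpow_le_rpow hκ.le hκ2 (by linarith)
  have h3 : m ^ p * m ^ (p - 1) ≤ m ^ (3 * p - 2) := by
    rw [← Real.rpow_add hm0]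
    exact Real.rpow_le_rpow_of_exponent_le hm (by linarith)
  have h4 : (Lam / lam) ^ (p - 1) ≤ (Lam / lam) ^ (2 * p - 2) :=
    Real.rpow_le_rpow_of_exponent_le ((one_le_div hlam).2 hLam) (by linarith)
  rw [h1]
  calc d ^ p * Lam ^ (p - 1) * (κ ^ p * (m / lam) ^ (p - 1))
      ≤ d ^ p * Lam ^ (p - 1) * ((m / lam) ^ p * (m / lam) ^ (p - 1)) := by gcongr
    _ = (m ^ p * m ^ (p - 1)) * (d / lam) ^ p * (Lam / lam) ^ (p - 1) := by
        rw [Real.div_rpow hm0.le hlam.le, Real.div_rpow hm0.le hlam.le, Real.div_rpow hd.le hlam.le,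
          Real.div_rpow hL.le hlam.le]
        ring
    _ ≤ _ := by gcongr

/-- the statement for globally Lipschitz maps -/
theorem main_global (n : ℕ) (hn : 1 ≤ n) (p : ℝ) (hp : 1 < p) :
    ∃ C₀ : ℝ, 0 < C₀ ∧
      ∀ (U : Set (EuclideanSpace ℝ (Fin n))), U.Nonempty → IsOpen U →
        IsBounded U →
      ∀ (u : EuclideanSpace ℝ (Fin n) → EuclideanSpace ℝ (Fin n)) (K : NNReal),
        LipschitzWith K u →
      ∀ (d : ℝ) (m : ℕ) (lam Lam : ℝ),
        diam (u '' U) ≤ d →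
        essSup (fun y => (U ∩ u ⁻¹' {y}).encard) volume ≤ (m : ℕ∞) →
        0 < lam →
        (∀ᵐ x ∂(volume.restrict U), DifferentiableAt ℝ u x ∧
            lam ≤ detD u x ∧ detD u x ≤ Lam) →
        ∃ (s : EuclideanSpace ℝ (Fin n) → EuclideanSpace ℝ (Fin n)) (Ks : NNReal),
          LipschitzWith Ks s ∧
          (∃ B : Set (EuclideanSpace ℝ (Fin n)), MeasurableSet B ∧
            Measure.map s (volume.restrict U) = volume.restrict B) ∧
          (∫ x in U,
              ‖u x - (((volume (u '' U)).toReal / (volume U).toReal) ^ ((n : ℝ))⁻¹) • s x‖ ^ p)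
            ≤ C₀ * (m : ℝ) ^ (3 * p - 2) * (d / lam) ^ p * (Lam / lam) ^ (2 * p - 2) *
              ∫ x in U, |(volume (u '' U)).toReal / (volume U).toReal -
                ((omegaFn U u (u x))⁻¹).toReal| ^ p := by
  have hp0 : 0 < p := by linarith
  set CE : ENNReal := ((((Fintype.card (Fin n) : NNReal) ^ (1 / (2 : ENNReal)).toReal : NNReal) : ENNReal) ^ p *
          ((2 ^ p * 2 ^ p + 1) * (knC p n + 1))) with hCE
  have hCEt : CE ≠ ⊤ := by
    rw [hCE]
    refine ENNReal.mul_ne_top (ENNReal.rpow_ne_top_of_nonneg hp0.le ENNReal.coe_ne_top)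
      (ENNReal.mul_ne_top (ENNReal.add_ne_top.2 ⟨ENNReal.mul_ne_top ?_ ?_, ENNReal.one_ne_top⟩)
      (ENNReal.add_ne_top.2 ⟨knC_ne_top p hp n, ENNReal.one_ne_top⟩)) <;>
    exact ENNReal.rpow_ne_top_of_nonneg hp0.le (by simp)
  refine ⟨CE.toReal + 1, by positivity, ?_⟩
  intro U hU0 hUo hUb u K hu d m lam Lam hdiam hmult hlam hae
  have : Nonempty (Fin n) := ⟨⟨0, hn⟩⟩
  obtain ⟨E', f₀, hE, hEu, hEnull, hf₀, hfE, huE, hform⟩ :=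
    area_lemma U hUo u K hu m lam Lam hmult hlam hae
  have hUtop : volume U ≠ ⊤ := hUb.measure_lt_top.ne
  have hUpos : volume U ≠ 0 := (hUo.measure_pos volume hU0).ne'
  have hub : IsBounded (u '' U) := hu.isBounded_image hUb
  have hvE : volume (u '' U) = volume E' := by
    refine le_antisymm ?_ (measure_mono hEu)
    calc volume (u '' U) ≤ volume (E' ∪ (u '' U \ E')) := measure_mono (by intro y hy; by_cases h : y ∈ E' <;> simp [h, hy])
      _ ≤ _ := measure_union_le _ _
      _ = _ := by rw [hEnull, add_zero]
  have hEtop : volume E' ≠ ⊤ := by rw [← hvE]; exact hub.measure_lt_top.ne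
  have hEpos : volume E' ≠ 0 := by
    intro h
    have h1 := hform (fun _ => 1) measurable_const
    rw [Measure.restrict_eq_zero.2 h] at h1
    simp at h1
    exact hUpos h1
  have hneb : (ae (volume.restrict U)).NeBot := by
    rw [ae_neBot]
    intro h
    exact hUpos (Measure.restrict_eq_zero.1 h)
  have hLam : lam ≤ Lam := by
    obtain ⟨x, hx⟩ := hae.exists
    exact hx.2.1.trans hx.2.2
  have hL0 : 0 < Lam := lt_of_lt_of_le hlam hLam
  have hEne : E'.Nonempty := by
    rw [nonempty_iff_ne_empty]; rintro rfl; simp at hEpos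
  have hlo : 0 < 1 / Lam := by positivity
  have hm1 : (1 : ℝ) ≤ m := by
    obtain ⟨y, hy⟩ := hEne
    have h1 := hfE y hy
    have h2 : 0 < (m : ℝ) / lam := lt_of_lt_of_le hlo (h1.1.trans h1.2.1)
    have h3 : (0 : ℝ) < m := by
      by_contra hc
      have : (m : ℝ) = 0 := le_antisymm (not_lt.1 hc) (Nat.cast_nonneg m)
      rw [this] at h2; simp at h2
    have : 0 < m := by exact_mod_cast h3
    exact_mod_cast this
  have hd : 0 < d := by
    by_contra hc
    have h0 : diam (u '' U) = 0 := le_antisymm (hdiam.trans (not_lt.1 hc)) diam_nonneg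
    have hss : (u '' U).Subsingleton := by
      intro y hy z hz
      have := dist_le_diam_of_mem hub hy hz
      rw [h0] at this
      exact dist_le_zero.1 this
    have := hss.measure_zero volume
    rw [hvE] at this
    exact hEpos this
  set a := (volume (u '' U)).toReal with ha
  set q := (volume U).toReal with hq
  have ha0 : 0 < a := by rw [ha, hvE]; exact ENNReal.toReal_pos hEpos hEtop
  have hq0 : 0 < q := ENNReal.toReal_pos hUpos hUtop
  set κ := q / a with hκdef
  have hκ : 0 < κ := by positivity
  have hκi : a / q = κ⁻¹ := by rw [hκdef, inv_div]
  set c := (a / q) ^ ((n : ℝ))⁻¹ with hc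
  have hc0 : 0 < c := by positivity
  have hcn : c ^ n = κ⁻¹ := by
    rw [hc, Real.rpow_inv_natCast_pow (by positivity) (by omega), hκi]
  have hvol : volume U = ENNReal.ofReal κ * volume E' := by
    have e1 : volume U = ENNReal.ofReal q := (ENNReal.ofReal_toReal hUtop).symm
    have e2 : volume E' = ENNReal.ofReal a := by rw [ha, hvE]; exact (ENNReal.ofReal_toReal hEtop).symm
    rw [e1, e2, ← ENNReal.ofReal_mul hκ.le, hκdef, div_mul_cancel₀ _ ha0.ne']
  obtain ⟨hκ2, s, ⟨Ks, hKs⟩, hB, hcost⟩ := main_euc hn p hp U E' hUo hUb hU0 f₀ hf₀ (1 / Lam) (m / lam) hlo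
    (fun y hy => ⟨(hfE y hy).1, (hfE y hy).2.1⟩) hE u K hu hform huE d hd hEu hub hdiam κ c hκ hc0 hcn hvol
  refine ⟨s, Ks, hKs, hB, ?_⟩
  rw [← hCE] at hcost
  set I := ∫⁻ x in U, ‖κ⁻¹ - (f₀ (u x))⁻¹‖ₑ ^ p with hI
  have henorm : ∀ z : ℝ, ENNReal.ofReal (|z| ^ p) = ‖z‖ₑ ^ p := fun z => by
    rw [← ofReal_norm, ENNReal.ofReal_rpow_of_nonneg (norm_nonneg _) hp0.le, Real.norm_eq_abs]
  have hIt : I ≠ ⊤ := by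
    have h1 : I ≤ ∫⁻ x in U, ENNReal.ofReal ((κ⁻¹ + Lam) ^ p) := by
      apply lintegral_mono_ae
      filter_upwards [huE] with x hx
      rw [← henorm]
      apply ENNReal.ofReal_le_ofReal
      refine Real.rpow_le_rpow (abs_nonneg _) ?_ hp0.le
      have h2 := (hfE _ hx).1
      have h3 : 0 < f₀ (u x) := lt_of_lt_of_le hlo h2
      have h4 : (f₀ (u x))⁻¹ ≤ Lam := by
        rw [inv_le_comm₀ h3 hL0]; rwa [one_div] at h2
      have h5 : 0 < (f₀ (u x))⁻¹ := by positivity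
      have h6 : 0 < κ⁻¹ := by positivity
      rw [abs_le]; constructor <;> linarith
    refine ne_top_of_le_ne_top ?_ h1
    rw [setLIntegral_const]
    exact ENNReal.mul_ne_top ENNReal.ofReal_ne_top hUtop
  have hR : ∫ x in U, |a / q - ((omegaFn U u (u x))⁻¹).toReal| ^ p = I.toReal := by
    have e1 : ∫ x in U, |a / q - ((omegaFn U u (u x))⁻¹).toReal| ^ p =
        ∫ x in U, |κ⁻¹ - (f₀ (u x))⁻¹| ^ p := by
      apply integral_congr_ae
      filter_upwards [huE] with x hx
      have h3 : 0 < f₀ (u x) := lt_of_lt_of_le hlo (hfE _ hx).1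
      rw [(hfE _ hx).2.2, hκi, ENNReal.toReal_inv, ENNReal.toReal_ofReal h3.le]
    have hmeas : Measurable fun x => |κ⁻¹ - (f₀ (u x))⁻¹| ^ p := by
      have h1 : Measurable fun x => κ⁻¹ - (f₀ (u x))⁻¹ :=
        measurable_const.sub (hf₀.comp hu.continuous.measurable).inv
      exact (continuous_abs.measurable.comp h1).pow_const p
    rw [e1, integral_eq_lintegral_of_nonneg_ae (Filter.Eventually.of_forall fun x => by positivity)
      hmeas.aestronglyMeasurable]
    simp only [henorm, hI]
  have hLft : ∫ x in U, ‖u x - c • s x‖ ^ p = (∫⁻ x in U, ‖u x - c • s x‖ₑ ^ p).toReal := by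
    have hcont : Continuous fun x => ‖u x - c • s x‖ ^ p :=
      ((hu.continuous.sub (hKs.continuous.const_smul c)).norm).rpow_const fun _ => Or.inr hp0.le
    rw [integral_eq_lintegral_of_nonneg_ae (Filter.Eventually.of_forall fun x => by positivity)
      hcont.aestronglyMeasurable]
    congr 1
    refine lintegral_congr fun x => ?_
    rw [← ofReal_norm, ENNReal.ofReal_rpow_of_nonneg (norm_nonneg _) hp0.le]
  rw [hR, hLft]
  set V := d ^ p * (1 / Lam) ^ (1 - p) * (κ ^ p * (m / lam) ^ (p - 1)) with hV
  have hV0 : 0 ≤ V := by positivity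
  have hcost' : ∫⁻ x in U, ‖u x - c • s x‖ₑ ^ p ≤ CE * (ENNReal.ofReal V * I) := by
    refine hcost.trans (le_of_eq ?_)
    congr 1
    rw [← mul_assoc, hV, ENNReal.ofReal_rpow_of_pos hd, ENNReal.ofReal_rpow_of_pos hlo,
      ← ENNReal.ofReal_mul (by positivity), ← ENNReal.ofReal_mul (by positivity)]
  have h1 := ENNReal.toReal_mono (ENNReal.mul_ne_top hCEt (ENNReal.mul_ne_top ENNReal.ofReal_ne_top hIt)) hcost'
  rw [ENNReal.toReal_mul (a := CE), ENNReal.toReal_mul (a := ENNReal.ofReal V), ENNReal.toReal_ofReal hV0] at h1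
  have hVle := const_ineq p hp m d lam Lam κ hm1 hd hlam hLam hκ hκ2
  rw [← hV] at hVle
  have hI0 : 0 ≤ I.toReal := ENNReal.toReal_nonneg
  have hC0 : 0 ≤ CE.toReal := ENNReal.toReal_nonneg
  calc _ ≤ _ := h1
    _ ≤ (CE.toReal + 1) * (((m : ℝ) ^ (3 * p - 2) * (d / lam) ^ p * (Lam / lam) ^ (2 * p - 2)) * I.toReal) := by
        gcongr
        linarith
    _ = _ := by ring

theorem detD_congr {n : ℕ} {U : Set (EuclideanSpace ℝ (Fin n))} (hUo : IsOpen U)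
    {u v : EuclideanSpace ℝ (Fin n) → EuclideanSpace ℝ (Fin n)} (h : EqOn u v U)
    {x : EuclideanSpace ℝ (Fin n)} (hx : x ∈ U) :
    detD u x = detD v x ∧ (DifferentiableAt ℝ u x ↔ DifferentiableAt ℝ v x) := by
  have he : u =ᶠ[nhds x] v := Filter.eventuallyEq_of_mem (hUo.mem_nhds hx) h
  exact ⟨by unfold detD; rw [he.fderiv_eq], he.differentiableAt_iff⟩

theorem omega_congr {n : ℕ} {U : Set (EuclideanSpace ℝ (Fin n))} (hUo : IsOpen U)
    {u v : EuclideanSpace ℝ (Fin n) → EuclideanSpace ℝ (Fin n)} (h : EqOn u v U)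
    (y : EuclideanSpace ℝ (Fin n)) : omegaFn U u y = omegaFn U v y := by
  have e : ∀ w : EuclideanSpace ℝ (Fin n) → EuclideanSpace ℝ (Fin n),
      omegaFn U w y = ∑' x, {x | x ∈ U ∧ w x = y ∧ DifferentiableAt ℝ w x ∧ 0 < detD w x}.indicator
        (fun x => ENNReal.ofReal (detD w x)⁻¹) x := by
    intro w
    rw [← tsum_subtype]
    rfl
  rw [e, e]
  congr 1
  ext x
  by_cases hx : x ∈ U
  · have h1 := detD_congr hUo h hx
    have h2 := h hx
    have hiff : (x ∈ {x | x ∈ U ∧ u x = y ∧ DifferentiableAt ℝ u x ∧ 0 < detD u x}) ↔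
        (x ∈ {x | x ∈ U ∧ v x = y ∧ DifferentiableAt ℝ v x ∧ 0 < detD v x}) := by
      change (x ∈ U ∧ u x = y ∧ DifferentiableAt ℝ u x ∧ 0 < detD u x) ↔
        (x ∈ U ∧ v x = y ∧ DifferentiableAt ℝ v x ∧ 0 < detD v x)
      rw [h1.1, h1.2, h2]
    by_cases hm : x ∈ {x | x ∈ U ∧ v x = y ∧ DifferentiableAt ℝ v x ∧ 0 < detD v x}
    · rw [indicator_of_mem hm, indicator_of_mem (hiff.2 hm), h1.1]
    · rw [indicator_of_notMem hm, indicator_of_notMem (fun hc => hm (hiff.1 hc))]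
  · rw [indicator_of_notMem (fun hc => hx hc.1), indicator_of_notMem (fun hc => hx hc.1)]

theorem stmt_2 (n : ℕ) (hn : 1 ≤ n) (p : ℝ) (hp : 1 < p) :
    ∃ C₀ : ℝ, 0 < C₀ ∧
      ∀ (U : Set (EuclideanSpace ℝ (Fin n))), U.Nonempty → IsOpen U →
        IsBounded U → IsConnected U →
      ∀ (u : EuclideanSpace ℝ (Fin n) → EuclideanSpace ℝ (Fin n)) (K : NNReal),
        LipschitzOnWith K u U → IsBounded (u '' U) →
      ∀ (d : ℝ) (m : ℕ) (lam Lam : ℝ),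
        diam (u '' U) ≤ d →
        essSup (fun y => (U ∩ u ⁻¹' {y}).encard) volume ≤ (m : ℕ∞) →
        0 < lam →
        (∀ᵐ x ∂(volume.restrict U), DifferentiableAt ℝ u x ∧
            lam ≤ detD u x ∧ detD u x ≤ Lam) →
        ∃ (s : EuclideanSpace ℝ (Fin n) → EuclideanSpace ℝ (Fin n)) (Ks : NNReal),
          LipschitzOnWith Ks s U ∧ IsBounded (s '' U) ∧
          (∃ B : Set (EuclideanSpace ℝ (Fin n)), MeasurableSet B ∧
            Measure.map s (volume.restrict U) = volume.restrict B) ∧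
          (∫ x in U,
              ‖u x - (((volume (u '' U)).toReal / (volume U).toReal) ^ ((n : ℝ))⁻¹) • s x‖ ^ p)
            ≤ C₀ * (m : ℝ) ^ (3 * p - 2) * (d / lam) ^ p * (Lam / lam) ^ (2 * p - 2) *
              ∫ x in U, |(volume (u '' U)).toReal / (volume U).toReal -
                ((omegaFn U u (u x))⁻¹).toReal| ^ p := by
  obtain ⟨C₀, hC₀, H⟩ := main_global n hn p hp
  refine ⟨C₀, hC₀, ?_⟩
  intro U hU0 hUo hUb _ u K hu hub d m lam Lam hdiam hmult hlam hae
  obtain ⟨v, hv, huv⟩ := hu.extend_finite_dimension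
  have him : v '' U = u '' U := huv.symm.image_eq
  have hpre : ∀ y, U ∩ v ⁻¹' {y} = U ∩ u ⁻¹' {y} := by
    intro y
    ext x
    constructor
    · rintro ⟨h1, h2⟩
      exact ⟨h1, (huv h1).trans h2⟩
    · rintro ⟨h1, h2⟩
      exact ⟨h1, (huv h1).symm.trans h2⟩
  obtain ⟨s, Ks, hs, hB, hI⟩ := H U hU0 hUo hUb v _ hv d m lam Lam (by rw [him]; exact hdiam)
    (by simp only [hpre]; exact hmult) hlam
    (by
      filter_upwards [hae, ae_restrict_mem hUo.measurableSet] with x hx hxU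
      have h1 := detD_congr hUo huv hxU
      rw [← h1.1, ← h1.2]
      exact hx)
  refine ⟨s, Ks, hs.lipschitzOnWith, hs.isBounded_image hUb, hB, ?_⟩
  rw [him] at hI
  have e1 : ∀ c : ℝ, ∫ x in U, ‖u x - c • s x‖ ^ p = ∫ x in U, ‖v x - c • s x‖ ^ p := fun c =>
    setIntegral_congr_fun hUo.measurableSet fun x hx => by simp only [huv hx]
  have e2 : ∀ c : ℝ, ∫ x in U, |c - ((omegaFn U u (u x))⁻¹).toReal| ^ p =
      ∫ x in U, |c - ((omegaFn U v (v x))⁻¹).toReal| ^ p := fun c =>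
    setIntegral_congr_fun hUo.measurableSet fun x hx => by
      simp only [huv hx, omega_congr hUo huv]
  rw [e1, e2]
  exact hI

end
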